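/- Under the normalized setup, sup over all e ∈ E and all X ∈ ℝ^{n+1}_− of Δ_e²u(X) is finite. -/

import Mathlib

open Set MeasureTheory

noncomputable section

abbrev En (n : ℕ) : Type := EuclideanSpace ℝ (Fin n)

namespace PMA

variable {n : ℕ}

/-- The lower half-space `ℝⁿ × (−∞,0]`. -/
def halfSpace (n : ℕ) : Set (En n × ℝ) := univ ×ˢ Iic (0:ℝ)

/-- The time derivative `u_t`. -/
def timeDeriv (u : En n → ℝ → ℝ) (x : En n) (t : ℝ) : ℝ := deriv (u x) t

/-- The spatial gradient `D_x u`. -/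
def spaceGrad (u : En n → ℝ → ℝ) (x : En n) (t : ℝ) : En n := gradient (fun y => u y t) x

/-- The spatial Hessian `D_x² u`, as an `n × n` matrix. -/
def spaceHess (u : En n → ℝ → ℝ) (x : En n) (t : ℝ) : Matrix (Fin n) (Fin n) ℝ :=
  fun i j => iteratedFDeriv ℝ 2 (fun y => u y t) x
    ![EuclideanSpace.single i 1, EuclideanSpace.single j 1]

/-- A function is parabolically convex on `D` if it is convex in `x` and nonincreasing in `t`. -/
def ParabolicallyConvexOn (D : Set (En n × ℝ)) (u : En n → ℝ → ℝ) : Prop :=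
  (∀ t : ℝ, ConvexOn ℝ {x | (x, t) ∈ D} (fun x => u x t)) ∧
  (∀ x : En n, ∀ s t : ℝ, s ≤ t → (x, s) ∈ D → (x, t) ∈ D → u x t ≤ u x s)

/-- The time slice `D(t)`. -/
def slice (D : Set (En n × ℝ)) (t : ℝ) : Set (En n) := {x | (x, t) ∈ D}

/-- Bowl-shaped domain. -/
def IsBowlShaped (D : Set (En n × ℝ)) : Prop :=
  D ⊆ halfSpace n ∧ (∀ t, Convex ℝ (slice D t)) ∧
  ∀ t₁ t₂ : ℝ, t₁ ≤ t₂ → (slice D t₂).Nonempty → slice D t₁ ⊆ slice D t₂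

/-- The parabolic boundary `∂_p D`. -/
def parabolicBoundary (D : Set (En n × ℝ)) : Set (En n × ℝ) :=
  (closure (slice D (sInf {t | (slice D t).Nonempty})) ×ˢ
      ({sInf {t | (slice D t).Nonempty}} : Set ℝ)) ∪
  ⋃ t ∈ Iic (0:ℝ), frontier (slice D t) ×ˢ ({t} : Set ℝ)

/-- Parabolic distance between two points. -/
def pdist (X Y : En n × ℝ) : ℝ := Real.sqrt (‖X.1 - Y.1‖^2 + |X.2 - Y.2|)

/-- Parabolic distance from a point to a set. -/
def pdistSet (Z : En n × ℝ) (S : Set (En n × ℝ)) : ℝ := sInf (pdist Z '' S)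

/-- `C^{2k,k}` regularity on a set: all mixed derivatives `D_x^i D_t^j u` with `i + 2j ≤ 2k`
exist and are continuous. -/
def IsC2kOn (k : ℕ) (u : En n → ℝ → ℝ) (D : Set (En n × ℝ)) : Prop :=
  ∀ i j : ℕ, i + 2*j ≤ 2*k →
    (∀ p ∈ D, ContDiffAt ℝ i (fun y => iteratedDeriv j (u y) p.2) p.1 ∧
      ContDiffAt ℝ j (u p.1) p.2) ∧
    ContinuousOn
      (fun p : En n × ℝ => iteratedFDeriv ℝ i (fun y => iteratedDeriv j (u y) p.2) p.1) D

/-- A matrix acting on `ℝⁿ`. -/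
def mApply (M : Matrix (Fin n) (Fin n) ℝ) (x : En n) : En n :=
  (WithLp.equiv 2 (Fin n → ℝ)).symm (M.mulVec (WithLp.equiv 2 (Fin n → ℝ) x))

/-- The quadratic form `xᵀ A x`. -/
def quadForm (A : Matrix (Fin n) (Fin n) ℝ) (x : En n) : ℝ := ∑ i, ∑ j, A i j * x i * x j

/-- The dot product `b · x` on `ℝⁿ`. -/
def dotp (b x : En n) : ℝ := ∑ i, b i * x i

/-- Second-order difference quotient `Δ_e² u`. -/
def sdq (u : En n → ℝ → ℝ) (e : En n) (x : En n) (t : ℝ) : ℝ :=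
  (u (x + e) t + u (x - e) t - 2 * u x t) / ‖e‖^2

end PMA

namespace PMA

section Determinants

open scoped Matrix MatrixOrder in
/-- A positive definite matrix is congruent to the identity. -/
lemma exists_conjTranspose_mul_mul_eq_one {n : ℕ} {A : Matrix (Fin n) (Fin n) ℝ}
    (hA : A.PosDef) : ∃ N : Matrix (Fin n) (Fin n) ℝ, Nᴴ * A * N = 1 := by
  obtain ⟨y, hy⟩ := CStarAlgebra.nonneg_iff_eq_star_mul_self.mp hA.posSemidef.nonneg
  have hdet : IsUnit y.det := by
    have h : A.det = (star y * y).det := by rw [← hy]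
    rw [Matrix.det_mul] at h
    refine isUnit_iff_ne_zero.2 fun h0 => ?_
    rw [h0, mul_zero] at h
    exact hA.det_pos.ne' h
  refine ⟨y⁻¹, ?_⟩
  rw [hy, Matrix.star_eq_conjTranspose, Matrix.conjTranspose_nonsing_inv]
  have hdet' : IsUnit (yᴴ).det := by rw [Matrix.det_conjTranspose]; simpa using hdet
  rw [← Matrix.mul_assoc, Matrix.nonsing_inv_mul _ hdet', Matrix.one_mul,
    Matrix.mul_nonsing_inv _ hdet]

lemma card_add_one_le_trace_add {n : ℕ} {B : Matrix (Fin n) (Fin n) ℝ} (hB : B.PosSemidef)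
    {b : ℝ} (hb : 0 < b) (h : b * B.det = 1) : (n : ℝ) + 1 ≤ B.trace + b := by
  have hdet : 0 < B.det := by
    rcases hB.det_nonneg.lt_or_eq with h1 | h1
    · exact h1
    · rw [← h1, mul_zero] at h; norm_num at h
  have hpd : B.PosDef := hB.posDef_iff_det_ne_zero.2 hdet.ne'
  have htr : B.trace = ∑ i, hB.1.eigenvalues i := by
    simpa using hB.1.trace_eq_sum_eigenvalues
  have hd : B.det = ∏ i, hB.1.eigenvalues i := by
    simpa using hB.1.det_eq_prod_eigenvalues
  have hpos : ∀ i, 0 < hB.1.eigenvalues i := fun i => hpd.eigenvalues_pos i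
  have hlog : Real.log b + ∑ i, Real.log (hB.1.eigenvalues i) = 0 := by
    rw [← Real.log_prod (fun i _ => (hpos i).ne'), ← hd, ← Real.log_mul hb.ne' hdet.ne', h,
      Real.log_one]
  have h1 : ∑ i, Real.log (hB.1.eigenvalues i) ≤ ∑ i, (hB.1.eigenvalues i - 1) :=
    Finset.sum_le_sum fun i _ => Real.log_le_sub_one_of_pos (hpos i)
  have h2 := Real.log_le_sub_one_of_pos hb
  rw [Finset.sum_sub_distrib] at h1
  simp at h1
  rw [htr]
  linarith

lemma det_le_pow_of_trace_le {n : ℕ} {C : Matrix (Fin n) (Fin n) ℝ} (hC : C.PosSemidef)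
    {s : ℝ} (h : C.trace ≤ s) : C.det ≤ s ^ n := by
  have htr : C.trace = ∑ i, hC.1.eigenvalues i := by
    simpa using hC.1.trace_eq_sum_eigenvalues
  have hd : C.det = ∏ i, hC.1.eigenvalues i := by
    simpa using hC.1.det_eq_prod_eigenvalues
  have hnn : ∀ i, 0 ≤ hC.1.eigenvalues i := fun i => hC.eigenvalues_nonneg i
  rw [hd]
  calc ∏ i, hC.1.eigenvalues i ≤ ∏ _i : Fin n, s := by
        refine Finset.prod_le_prod (fun i _ => hnn i) fun i _ => ?_
        refine le_trans ?_ (htr ▸ h)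
        exact Finset.single_le_sum (fun j _ => hnn j) (Finset.mem_univ i)
    _ = s ^ n := by simp

open scoped Matrix in
/-- Concavity of the parabolic Monge-Ampère operator at a point where `u - w / κ` is touched from
below by an affine function, `w` being a second difference of `u`. -/
lemma contact_bounds {n : ℕ} {A Bp Bm : Matrix (Fin n) (Fin n) ℝ} {a bp bm κ : ℝ}
    (hA : A.PosDef) (hBp : Bp.PosSemidef) (hBm : Bm.PosSemidef) (ha : 0 < a) (hbp : 0 < bp)
    (hbm : 0 < bm) (hp : bp * Bp.det = a * A.det) (hm : bm * Bm.det = a * A.det) (hκ : 0 < κ)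
    (hC : (A - κ⁻¹ • (Bp + Bm - (2 : ℝ) • A)).PosSemidef)
    (hs : 0 ≤ a - κ⁻¹ * (bp + bm - 2 * a)) :
    a - κ⁻¹ * (bp + bm - 2 * a) ≤ (n + 1) * a ∧
      |(A - κ⁻¹ • (Bp + Bm - (2 : ℝ) • A)).det| ≤ (n + 1) ^ n * A.det := by
  obtain ⟨N, hN⟩ := exists_conjTranspose_mul_mul_eq_one hA
  have hdet : N.det * A.det * N.det = 1 := by
    have := congrArg Matrix.det hN
    simpa [Matrix.det_mul] using this
  have key : ∀ {B : Matrix (Fin n) (Fin n) ℝ} {b : ℝ}, B.PosSemidef → 0 < b →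
      b * B.det = a * A.det → (n : ℝ) + 1 ≤ (Nᴴ * B * N).trace + b / a := by
    intro B b hB hb h
    refine card_add_one_le_trace_add (hB.conjTranspose_mul_mul_same N) (div_pos hb ha) ?_
    have : (Nᴴ * B * N).det = N.det * B.det * N.det := by simp [Matrix.det_mul]
    rw [this]
    field_simp
    calc b * N.det ^ 2 * B.det = N.det ^ 2 * (b * B.det) := by ring
      _ = a * (N.det * A.det * N.det) := by rw [h]; ring
      _ = a := by rw [hdet, mul_one]
  have h1 := key hBp hbp hp
  have h2 := key hBm hbm hm
  set C := A - κ⁻¹ • (Bp + Bm - (2 : ℝ) • A) with hCdef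
  have hCN : Nᴴ * C * N = 1 - κ⁻¹ • (Nᴴ * Bp * N + Nᴴ * Bm * N - (2 : ℝ) • 1) := by
    rw [← hN, hCdef]
    simp only [Matrix.mul_sub, Matrix.sub_mul, Matrix.mul_add, Matrix.add_mul, Matrix.mul_smul,
      Matrix.smul_mul]
  have hCpos : (Nᴴ * C * N).PosSemidef := hC.conjTranspose_mul_mul_same N
  have htr : (Nᴴ * C * N).trace
      = n - κ⁻¹ * ((Nᴴ * Bp * N).trace + (Nᴴ * Bm * N).trace - 2 * n) := by
    rw [hCN]
    simp
  have htr0 : 0 ≤ (Nᴴ * C * N).trace := hCpos.trace_nonneg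
  set σ := a - κ⁻¹ * (bp + bm - 2 * a) with hσ
  have hσa : σ / a = 1 - κ⁻¹ * (bp / a + bm / a - 2) := by
    rw [hσ]; field_simp
  have hσ0 : 0 ≤ σ / a := div_nonneg hs ha.le
  have hsum : (Nᴴ * C * N).trace + σ / a ≤ n + 1 := by
    have : 0 ≤ κ⁻¹ * ((Nᴴ * Bp * N).trace + bp / a + ((Nᴴ * Bm * N).trace + bm / a)
      - 2 * (n + 1)) := mul_nonneg (inv_nonneg.2 hκ.le) (by linarith)
    rw [htr, hσa]
    linarith
  constructor
  · have : σ / a ≤ n + 1 := by linarith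
    rwa [div_le_iff₀ ha] at this
  · rw [abs_of_nonneg hC.det_nonneg]
    have h3 := det_le_pow_of_trace_le hCpos (s := n + 1) (by linarith)
    have h4 : (Nᴴ * C * N).det = N.det * C.det * N.det := by simp [Matrix.det_mul]
    rw [h4] at h3
    have hdA := hA.det_pos
    calc C.det = (N.det * C.det * N.det) * A.det := by
          linear_combination (-C.det) * hdet
      _ ≤ (n + 1) ^ n * A.det := by gcongr

end Determinants

section Gradients

open Filter Topology

/-- The Hessian matrix of a function on `ℝⁿ`. -/
def hess {n : ℕ} (v : En n → ℝ) (x : En n) : Matrix (Fin n) (Fin n) ℝ :=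
  fun i j => iteratedFDeriv ℝ 2 v x ![EuclideanSpace.single i 1, EuclideanSpace.single j 1]

lemma hess_apply {n : ℕ} (v : En n → ℝ) (x : En n) (i j : Fin n) :
    hess v x i j
      = fderiv ℝ (fderiv ℝ v) x (EuclideanSpace.single i 1) (EuclideanSpace.single j 1) := by
  simp [hess, iteratedFDeriv_two_apply]

lemma fderiv_fderiv_eq_dotProduct {n : ℕ} (v : En n → ℝ) (x ξ η : En n) :
    fderiv ℝ (fderiv ℝ v) x ξ η = (ξ : Fin n → ℝ) ⬝ᵥ (hess v x).mulVec η := by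
  have h : ∀ ζ : En n, ζ = ∑ i, ζ i • EuclideanSpace.single i (1 : ℝ) := by
    intro ζ
    simpa using ((EuclideanSpace.basisFun (Fin n) ℝ).sum_repr ζ).symm
  conv_lhs => rw [h ξ, h η]
  simp only [map_sum, map_smul, dotProduct, Matrix.mulVec, hess_apply,
    _root_.sum_apply, _root_.smul_apply, smul_eq_mul]
  simp only [Finset.mul_sum]
  rw [Finset.sum_comm]
  refine Finset.sum_congr rfl fun i _ => Finset.sum_congr rfl fun j _ => by ring

lemma hess_add {n : ℕ} {v w : En n → ℝ} (hv : ContDiff ℝ 2 v) (hw : ContDiff ℝ 2 w) (x : En n) :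
    hess (fun y => v y + w y) x = hess v x + hess w x := by
  ext i j
  have := iteratedFDeriv_add_apply (x := x) (i := 2) (f := v) (g := w) hv.contDiffAt hw.contDiffAt
  simp only [hess, Matrix.add_apply]
  rw [show (fun y => v y + w y) = v + w from rfl, this]
  rfl

lemma hess_const_mul {n : ℕ} {v : En n → ℝ} (hv : ContDiff ℝ 2 v) (c : ℝ) (x : En n) :
    hess (fun y => c * v y) x = c • hess v x := by
  ext i j
  have := iteratedFDeriv_const_smul_apply (x := x) (i := 2) (f := v) (a := c) hv.contDiffAt
  simp only [hess, Matrix.smul_apply]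
  rw [show (fun y => c * v y) = c • v from rfl, this]
  rfl

lemma hess_comp_add {n : ℕ} (v : En n → ℝ) (a x : En n) :
    hess (fun y => v (y + a)) x = hess v (x + a) := by
  ext i j
  simp only [hess, iteratedFDeriv_comp_add_right]

lemma contDiff_affine {n : ℕ} (p x₀ : En n) (c : ℝ) :
    ContDiff ℝ 2 (fun y : En n => c + inner ℝ p (y - x₀)) :=
  contDiff_const.add (contDiff_const.inner ℝ (contDiff_id.sub contDiff_const))

lemma fderiv_affine {n : ℕ} (p x₀ : En n) (c : ℝ) :
    fderiv ℝ (fun y : En n => c + inner ℝ p (y - x₀)) = fun _ => innerSL ℝ p := by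
  ext1 x
  refine HasFDerivAt.fderiv ?_
  have h := (innerSL ℝ p).hasFDerivAt (x := x - x₀)
  have h2 := h.comp x ((hasFDerivAt_id x).sub_const x₀)
  have h3 := h2.const_add c
  simpa using h3

lemma hess_affine {n : ℕ} (p x₀ : En n) (c : ℝ) (x : En n) :
    hess (fun y : En n => c + inner ℝ p (y - x₀)) x = 0 := by
  ext i j
  rw [hess_apply, fderiv_affine]
  simp

lemma inner_gradient {n : ℕ} (v : En n → ℝ) (x ξ : En n) :
    inner ℝ (gradient v x) ξ = fderiv ℝ v x ξ := by
  rw [gradient, InnerProductSpace.toDual_symm_apply]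

/-- The derivative of the gradient map has the determinant of the Hessian. -/
lemma exists_hasFDerivAt_gradient {n : ℕ} {v : En n → ℝ} (hv : ContDiff ℝ 2 v) (x : En n) :
    ∃ H : En n →L[ℝ] En n, HasFDerivAt (gradient v) H x ∧ H.det = (hess v x).det := by
  have h1 : DifferentiableAt ℝ (fderiv ℝ v) x :=
    ((hv.fderiv_right (m := 1) (by norm_num)).differentiable (by norm_num)) x
  let L : (En n →L[ℝ] ℝ) →L[ℝ] En n :=
    { toFun := (InnerProductSpace.toDual ℝ (En n)).symm
      map_add' := map_add _
      map_smul' := fun c φ => by simp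
      cont := (InnerProductSpace.toDual ℝ (En n)).symm.continuous }
  have h2 : HasFDerivAt (gradient v) (L.comp (fderiv ℝ (fderiv ℝ v) x)) x :=
    L.hasFDerivAt.comp x h1.hasFDerivAt
  refine ⟨_, h2, ?_⟩
  rw [ContinuousLinearMap.det,
    ← LinearMap.det_toMatrix (EuclideanSpace.basisFun (Fin n) ℝ).toBasis, ← Matrix.det_transpose]
  congr 1
  ext i j
  rw [Matrix.transpose_apply, LinearMap.toMatrix_apply, hess_apply]
  simp only [OrthonormalBasis.coe_toBasis, OrthonormalBasis.coe_toBasis_repr_apply,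
    EuclideanSpace.basisFun_apply, EuclideanSpace.basisFun_repr]
  have h3 : ∀ φ : En n →L[ℝ] ℝ, (L φ) j = φ (EuclideanSpace.single j 1) := by
    intro φ
    have : inner ℝ (L φ) (EuclideanSpace.single j (1 : ℝ)) = φ (EuclideanSpace.single j 1) :=
      InnerProductSpace.toDual_symm_apply
    rw [← this, real_inner_comm]
    simp [EuclideanSpace.inner_single_left]
  exact h3 _

lemma hess_isHermitian {n : ℕ} {v : En n → ℝ} (hv : ContDiff ℝ 2 v) (x : En n) :
    (hess v x).IsHermitian := by
  ext i j
  rw [Matrix.conjTranspose_apply, hess_apply, hess_apply]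
  have : IsSymmSndFDerivAt ℝ v x := hv.contDiffAt.isSymmSndFDerivAt (by simp)
  simpa using this.eq _ _

lemma hasDerivAt_line {n : ℕ} {v : En n → ℝ} (hv : Differentiable ℝ v) (x ξ : En n) (s : ℝ) :
    HasDerivAt (fun s : ℝ => v (x + s • ξ)) (fderiv ℝ v (x + s • ξ) ξ) s := by
  have h1 : HasDerivAt (fun s : ℝ => x + s • ξ) ξ s := by
    simpa using ((hasDerivAt_id s).smul_const ξ).const_add x
  exact (hv _).hasFDerivAt.comp_hasDerivAt s h1

lemma hess_posSemidef_of_isLocalMin {n : ℕ} {v : En n → ℝ} (hv : ContDiff ℝ 2 v) {x : En n}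
    (hmin : IsLocalMin v x) : (hess v x).PosSemidef := by
  refine Matrix.PosSemidef.of_dotProduct_mulVec_nonneg (hess_isHermitian hv x) fun ξ' => ?_
  set ξ : En n := WithLp.toLp 2 ξ' with hξ
  have hq := fderiv_fderiv_eq_dotProduct v x ξ ξ
  have hstar : star ξ' ⬝ᵥ (hess v x).mulVec ξ' = fderiv ℝ (fderiv ℝ v) x ξ ξ := by
    rw [hq]; simp [hξ]
  rw [hstar]
  by_contra! hneg
  have hd : Differentiable ℝ v := hv.differentiable (by norm_num)
  set g : ℝ → ℝ := fun s => v (x + s • ξ) with hg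
  have hg1 : deriv g = fun s => fderiv ℝ v (x + s • ξ) ξ := by
    ext s; exact (hasDerivAt_line hd x ξ s).deriv
  have hg2 : HasDerivAt (deriv g) (fderiv ℝ (fderiv ℝ v) x ξ ξ) 0 := by
    rw [hg1]
    have h1 : DifferentiableAt ℝ (fderiv ℝ v) (x + (0:ℝ) • ξ) :=
      ((hv.fderiv_right (m := 1) (by norm_num)).differentiable (by norm_num)) _
    have h2 : HasDerivAt (fun s : ℝ => x + s • ξ) ξ 0 := by
      simpa using ((hasDerivAt_id (0:ℝ)).smul_const ξ).const_add x
    have h3 := h1.hasFDerivAt.comp_hasDerivAt (0:ℝ) h2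
    simp only [zero_smul, add_zero] at h3
    exact h3.clm_apply (hasDerivAt_const (0:ℝ) ξ) |>.congr_deriv (by simp)
  have hmin' : IsLocalMin g 0 := by
    have hc : ContinuousAt (fun s : ℝ => x + s • ξ) 0 := by fun_prop
    have h2 : Tendsto (fun s : ℝ => x + s • ξ) (𝓝 0) (𝓝 x) := by simpa [ContinuousAt] using hc
    have := h2.eventually hmin
    simpa [IsLocalMin, IsMinFilter, hg] using this
  have hmax : IsLocalMax g 0 := by
    refine isLocalMax_of_deriv_deriv_neg (by rw [hg2.deriv]; exact hneg) hmin'.deriv_eq_zero ?_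
    exact (hasDerivAt_line hd x ξ 0).continuousAt
  have hconst : g =ᶠ[𝓝 0] fun _ => g 0 := by
    filter_upwards [hmin', hmax] with s h1 h2 using le_antisymm h2 h1
  have h0 : deriv g =ᶠ[𝓝 0] fun _ => 0 := by
    have := hconst.deriv
    simpa using this
  have := h0.deriv_eq
  rw [hg2.deriv] at this
  simp at this
  linarith

lemma gradient_eq_zero_of_isLocalMin {n : ℕ} {v : En n → ℝ} {x : En n}
    (hmin : IsLocalMin v x) : gradient v x = 0 := by
  rw [gradient, hmin.fderiv_eq_zero, map_zero]

/-- A convex differentiable function lies above its tangent planes. -/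
lemma le_of_convexOn {n : ℕ} {v : En n → ℝ} (hc : ConvexOn ℝ univ v)
    (hd : Differentiable ℝ v) (x y : En n) :
    v x + inner ℝ (gradient v x) (y - x) ≤ v y := by
  rw [inner_gradient]
  have hg : HasDerivAt (fun s : ℝ => v (x + s • (y - x))) (fderiv ℝ v x (y - x)) 0 := by
    simpa using hasDerivAt_line hd x (y - x) 0
  have hcg : ConvexOn ℝ univ (fun s : ℝ => v (x + s • (y - x))) := by
    have := hc.comp_affineMap (AffineMap.lineMap x y : ℝ →ᵃ[ℝ] En n)
    have h2 : (v ∘ (AffineMap.lineMap x y : ℝ →ᵃ[ℝ] En n))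
        = fun s : ℝ => v (x + s • (y - x)) := by
      ext s; simp [AffineMap.lineMap_apply, add_comm]
    rw [h2] at this
    simpa using this
  have := hcg.le_slope_of_hasDerivAt (mem_univ 0) (mem_univ 1) one_pos hg
  rw [slope_def_field, one_smul, zero_smul, add_zero, add_sub_cancel, sub_zero, div_one] at this
  linarith

lemma hess_posSemidef_of_convexOn {n : ℕ} {v : En n → ℝ} (hv : ContDiff ℝ 2 v)
    (hc : ConvexOn ℝ univ v) (x : En n) : (hess v x).PosSemidef := by
  have hd : Differentiable ℝ v := hv.differentiable (by norm_num)
  have h : hess (fun y => v y + (-1) * (v x + inner ℝ (gradient v x) (y - x))) x = hess v x := by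
    rw [hess_add hv (contDiff_const.mul (contDiff_affine _ _ _)),
      hess_const_mul (contDiff_affine _ _ _), hess_affine]
    simp
  rw [← h]
  refine hess_posSemidef_of_isLocalMin
    (hv.add (contDiff_const.mul (contDiff_affine _ _ _))) (Eventually.of_forall fun y => ?_)
  have := le_of_convexOn hc hd x y
  simp only [sub_self, inner_zero_right]
  linarith

end Gradients

section Boxes

open Filter Topology

/-- The linear map of `ℝⁿ` given by a matrix. -/
def lin {n : ℕ} (M : Matrix (Fin n) (Fin n) ℝ) : En n →ₗ[ℝ] En n := Matrix.toLpLin 2 2 M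

lemma det_lin {n : ℕ} (M : Matrix (Fin n) (Fin n) ℝ) : LinearMap.det (lin M) = M.det :=
  LinearMap.det_toLpLin 2 M

lemma lin_apply {n : ℕ} (M : Matrix (Fin n) (Fin n) ℝ) (y : En n) (i : Fin n) :
    lin M y i = ∑ j, M i j * y j := by
  simp [lin, Matrix.toLpLin_apply, Matrix.mulVec, dotProduct]

lemma inner_lin {n : ℕ} (M : Matrix (Fin n) (Fin n) ℝ) (p y : En n) :
    inner ℝ p (lin M y) = ∑ i, lin M.transpose p i * y i := by
  simp only [PiLp.inner_apply, lin_apply, Matrix.transpose_apply, RCLike.inner_apply,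
    conj_trivial, Finset.sum_mul]
  rw [Finset.sum_comm]
  exact Finset.sum_congr rfl fun i _ => Finset.sum_congr rfl fun j _ => by ring

/-- The closed box with half-widths `ρ`. -/
def box (n : ℕ) (ρ : ℝ) : Set (En n) := {y | ∀ i, |y i| ≤ ρ}

lemma isClosed_box (n : ℕ) (ρ : ℝ) : IsClosed (box n ρ) := by
  simp only [box, ofPred_forall]
  exact isClosed_iInter fun i => isClosed_le (by fun_prop) continuous_const

lemma isCompact_box (n : ℕ) (ρ : ℝ) : IsCompact (box n ρ) := by
  have h1 : box n ρ = WithLp.toLp 2 '' (Icc (fun _ : Fin n => -ρ) (fun _ => ρ)) := by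
    ext y
    constructor
    · intro hy
      exact ⟨y.ofLp, ⟨fun i => (abs_le.1 (hy i)).1, fun i => (abs_le.1 (hy i)).2⟩, rfl⟩
    · rintro ⟨z, hz, rfl⟩ i
      exact abs_le.2 ⟨hz.1 i, hz.2 i⟩
  rw [h1]
  exact isCompact_Icc.image (PiLp.continuous_toLp 2 _)

lemma volume_box (n : ℕ) {ρ : ℝ} (hρ : 0 ≤ ρ) :
    volume (box n ρ) = ENNReal.ofReal ((2 * ρ) ^ n) := by
  have h1 : box n ρ = WithLp.ofLp ⁻¹' (Icc (fun _ : Fin n => -ρ) (fun _ => ρ)) := by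
    ext y
    simp [box, abs_le, Pi.le_def, forall_and]
  rw [h1, (PiLp.volume_preserving_ofLp (Fin n)).measure_preimage
    measurableSet_Icc.nullMeasurableSet, Real.volume_Icc_pi]
  simp only [Finset.prod_const, Finset.card_univ, Fintype.card_fin]
  rw [← ENNReal.ofReal_pow (by linarith)]
  congr 2; ring

lemma volume_lin_preimage_box {n : ℕ} {M : Matrix (Fin n) (Fin n) ℝ} (hM : M.det ≠ 0) {ρ : ℝ}
    (hρ : 0 ≤ ρ) :
    volume (lin M ⁻¹' box n ρ) = ENNReal.ofReal ((2 * ρ) ^ n / |M.det|) := by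
  rw [Measure.addHaar_preimage_linearMap _ (by rwa [det_lin]), det_lin, volume_box n hρ,
    ← ENNReal.ofReal_mul (abs_nonneg _), abs_inv]
  congr 1; ring

lemma volume_lin_image_box {n : ℕ} (M : Matrix (Fin n) (Fin n) ℝ) {ρ : ℝ}
    (hρ : 0 ≤ ρ) :
    volume (lin M '' box n ρ) = ENNReal.ofReal (|M.det| * (2 * ρ) ^ n) := by
  rw [Measure.addHaar_image_linearMap, det_lin, volume_box n hρ,
    ← ENNReal.ofReal_mul (abs_nonneg _)]

lemma volume_image_add_left {n : ℕ} (a : En n) (S : Set (En n)) :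
    volume ((fun y => a + y) '' S) = volume S := by
  rw [Set.image_add_left, measure_preimage_add]

/-- Maximizing the determinant over simplices with vertices in a compact set `S` yields affine
coordinates in which `S` contains the standard simplex and is contained in the unit box. -/
lemma exists_box_coordinates {n : ℕ} {S : Set (En n)} (hS : IsCompact S)
    (hintr : (interior S).Nonempty) :
    ∃ q₀ ∈ S, ∃ M : Matrix (Fin n) (Fin n) ℝ, M.det ≠ 0 ∧
      (∀ i, q₀ + lin M (EuclideanSpace.single i 1) ∈ S) ∧
      ∀ q ∈ S, ∃ y ∈ box n 1, q = q₀ + lin M y := by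
  let F : (Fin n → En n) × En n → ℝ := fun q => |(Matrix.of fun i j => q.1 i j - q.2 j).det|
  have hF : Continuous F := by
    refine Continuous.abs (Continuous.matrix_det ?_)
    refine continuous_matrix fun i j => ?_
    simp only [Matrix.of_apply]
    fun_prop
  have hK : IsCompact ((Set.pi univ fun _ : Fin n => S) ×ˢ S) :=
    (isCompact_univ_pi fun _ => hS).prod hS
  obtain ⟨c, hc⟩ := hintr
  obtain ⟨ε, hε, hball⟩ := Metric.isOpen_iff.1 isOpen_interior c hc
  have hball' : Metric.ball c ε ⊆ S := hball.trans interior_subset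
  have hcS : c ∈ S := interior_subset hc
  obtain ⟨q, hq, hmax⟩ := hK.exists_isMaxOn ⟨(fun _ => c, c), by simp [hcS]⟩ hF.continuousOn
  simp only [Set.mem_prod, Set.mem_univ_pi] at hq
  set A : Matrix (Fin n) (Fin n) ℝ := Matrix.of fun i j => q.1 i j - q.2 j with hA
  have hpos : 0 < |A.det| := by
    have hmem : ((fun i => c + (ε / 2) • EuclideanSpace.single i (1:ℝ), c) :
        (Fin n → En n) × En n) ∈ (Set.pi univ fun _ : Fin n => S) ×ˢ S := by
      simp only [Set.mem_prod, Set.mem_univ_pi]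
      refine ⟨fun i => hball' ?_, hcS⟩
      simp [norm_smul, abs_of_pos hε, hε]
    have h1 := hmax hmem
    refine lt_of_lt_of_le ?_ h1
    have h2 : (Matrix.of fun i j => (c + (ε / 2) • EuclideanSpace.single i (1:ℝ) : En n) j - c j)
        = (ε / 2) • (1 : Matrix (Fin n) (Fin n) ℝ) := by
      ext i j
      simp [Matrix.one_apply, eq_comm]
    simp only [F]
    rw [h2, Matrix.det_smul]
    simp only [Fintype.card_fin, Matrix.det_one, mul_one]
    positivity
  have hdet : A.det ≠ 0 := abs_pos.1 hpos
  refine ⟨q.2, hq.2, A.transpose, by rwa [Matrix.det_transpose], fun i => ?_, fun z hz => ?_⟩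
  · convert hq.1 i using 1
    ext j
    simp [lin_apply, hA]
  · let b : Fin n → ℝ := fun j => z j - q.2 j
    refine ⟨WithLp.toLp 2 ((A.det)⁻¹ • A.transpose.cramer b), fun i => ?_, ?_⟩
    · simp only [Pi.smul_apply, smul_eq_mul, Matrix.cramer_transpose_apply]
      rw [abs_mul, abs_inv, inv_mul_le_iff₀ hpos, mul_one]
      have hmem : ((Function.update q.1 i z, q.2) :
          (Fin n → En n) × En n) ∈ (Set.pi univ fun _ : Fin n => S) ×ˢ S := by
        simp only [Set.mem_prod, Set.mem_univ_pi]
        refine ⟨fun j => ?_, hq.2⟩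
        by_cases hj : j = i
        · subst hj; simpa using hz
        · simpa [hj] using hq.1 j
      have h1 := hmax hmem
      have h2 : A.updateRow i b
          = Matrix.of fun i' j => (Function.update q.1 i z) i' j - q.2 j := by
        ext i' j
        by_cases hj : i' = i
        · subst hj; simp [b]
        · simp [hj, hA]
      rw [h2]
      exact h1
    · have h3 := Matrix.mulVec_cramer A.transpose b
      ext j
      have h4 : lin A.transpose (WithLp.toLp 2 ((A.det)⁻¹ • A.transpose.cramer b)) j = b j := by
        have : lin A.transpose (WithLp.toLp 2 ((A.det)⁻¹ • A.transpose.cramer b))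
            = WithLp.toLp 2 (A.transpose.mulVec ((A.det)⁻¹ • A.transpose.cramer b)) := by
          rw [lin, Matrix.toLpLin_apply]
        rw [this, Matrix.mulVec_smul, h3, Matrix.det_transpose, smul_smul, inv_mul_cancel₀ hdet,
          one_smul]
      rw [PiLp.add_apply, h4]
      simp [b]

/-- Pairwise disjoint translates of a set inside another set. -/
lemma mul_volume_le_of_disjoint_translates {n : ℕ} {K W : Set (En n)} (hK : MeasurableSet K)
    (a : ℕ → En n) (J : ℕ)
    (hdisj : ∀ i < J, ∀ j < J, i ≠ j → ∀ y ∈ K, ∀ z ∈ K, a i + y ≠ a j + z)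
    (hsub : ∀ i < J, ∀ y ∈ K, a i + y ∈ W) :
    (J : ENNReal) * volume K ≤ volume W := by
  have h1 : volume (⋃ i ∈ Finset.range J, (fun y => a i + y) '' K)
      = ∑ i ∈ Finset.range J, volume ((fun y => a i + y) '' K) := by
    refine measure_biUnion_finset ?_ fun i _ => ?_
    · intro i hi j hj hij
      rw [Function.onFun, Set.disjoint_left]
      rintro _ ⟨y, hy, rfl⟩ ⟨z, hz, hzy⟩
      exact hdisj i (by simpa using hi) j (by simpa using hj) hij y hy z hz hzy.symm
    · rw [Set.image_add_left]
      exact hK.preimage (measurable_const_add _)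
  simp only [volume_image_add_left, Finset.sum_const, Finset.card_range, nsmul_eq_mul] at h1
  rw [← h1]
  refine measure_mono (iUnion₂_subset fun i hi => ?_)
  rintro _ ⟨y, hy, rfl⟩
  exact hsub i (by simpa using hi) y hy

end Boxes

section Pinched

open Filter Topology

/-- Convex `C²` functions on `ℝⁿ` whose Monge-Ampère density is pinched between `l` and `L`. -/
structure Pinched {n : ℕ} (l L : ℝ) (v : En n → ℝ) : Prop where
  contDiff : ContDiff ℝ 2 v
  convexOn : ConvexOn ℝ univ v
  le_det : ∀ x, l ≤ (hess v x).det
  det_le : ∀ x, (hess v x).det ≤ L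

variable {n : ℕ} {l L : ℝ} {v : En n → ℝ}

lemma Pinched.differentiable (hv : Pinched l L v) : Differentiable ℝ v :=
  hv.contDiff.differentiable (by norm_num)

lemma Pinched.continuous (hv : Pinched l L v) : Continuous v := hv.contDiff.continuous

lemma Pinched.posDef (hl : 0 < l) (hv : Pinched l L v) (x : En n) : (hess v x).PosDef :=
  (hess_posSemidef_of_convexOn hv.contDiff hv.convexOn x).posDef_iff_det_ne_zero.2
    (hl.trans_le (hv.le_det x)).ne'

/-- The function `v` minus its tangent plane at `x`. -/
def tang (v : En n → ℝ) (x z : En n) : ℝ := v z - v x - inner ℝ (gradient v x) (z - x)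

lemma tang_self (v : En n → ℝ) (x : En n) : tang v x x = 0 := by simp [tang]

lemma tang_eq_add (v : En n → ℝ) (x z : En n) :
    tang v x z = v z + (-1) * (v x + inner ℝ (gradient v x) (z - x)) := by
  simp only [tang]; ring

lemma gradient_add_affine {v : En n → ℝ} (hv : Differentiable ℝ v) (p x₀ : En n) (c : ℝ)
    (x : En n) :
    gradient (fun y => v y + (-1) * (c + inner ℝ p (y - x₀))) x = gradient v x - p := by
  refine ext_inner_right ℝ fun ξ => ?_
  have h1 : HasFDerivAt (fun y : En n => c + inner ℝ p (y - x₀)) (innerSL ℝ p) x := by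
    rw [← congrFun (fderiv_affine p x₀ c) x]
    exact ((contDiff_affine p x₀ c).differentiable (by norm_num) x).hasFDerivAt
  have h2 := (hv x).hasFDerivAt.add (h1.const_mul (-1 : ℝ))
  rw [inner_gradient, inner_sub_left, inner_gradient]
  have h3 := h2.fderiv
  have : fderiv ℝ (fun y => v y + (-1) * (c + inner ℝ p (y - x₀))) x
      = fderiv ℝ v x + (-1 : ℝ) • innerSL ℝ p := h3
  rw [this]
  simp
  ring

lemma Pinched.add_affine (hv : Pinched l L v) (p x₀ : En n) (c : ℝ) :
    Pinched l L (fun y => v y + (-1) * (c + inner ℝ p (y - x₀))) := by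
  have h : ∀ x, hess (fun y => v y + (-1) * (c + inner ℝ p (y - x₀))) x = hess v x := by
    intro x
    rw [hess_add hv.contDiff (contDiff_const.mul (contDiff_affine _ _ _)),
      hess_const_mul (contDiff_affine _ _ _), hess_affine]
    simp
  refine ⟨hv.contDiff.add (contDiff_const.mul (contDiff_affine _ _ _)), ?_, ?_, ?_⟩
  · refine hv.convexOn.add ⟨convex_univ, fun x _ y _ a b _ _ hab => le_of_eq ?_⟩
    have hb : b = 1 - a := by linarith
    subst hb
    simp only [inner_add_right, inner_sub_right, inner_smul_right, smul_eq_mul]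
    ring
  · exact fun x => by rw [h]; exact hv.le_det x
  · exact fun x => by rw [h]; exact hv.det_le x

lemma Pinched.tang (hv : Pinched l L v) (x : En n) : Pinched l L (tang v x) := by
  have := hv.add_affine (gradient v x) x (v x)
  rwa [← funext (tang_eq_add v x)] at this

lemma gradient_tang (hv : Pinched l L v) (x y : En n) :
    gradient (PMA.tang v x) y = gradient v y - gradient v x := by
  rw [funext (tang_eq_add v x)]
  exact gradient_add_affine hv.differentiable _ _ _ _

lemma tang_nonneg (hv : Pinched l L v) (x z : En n) : 0 ≤ tang v x z := by
  have := le_of_convexOn hv.convexOn hv.differentiable x z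
  simp only [tang]; linarith

/-- Changing the base point of a tangent plane. -/
lemma tang_tang (hv : Pinched l L v) (x y z : En n) :
    tang (tang v x) y z = tang v y z := by
  have h := gradient_tang hv x y
  rw [tang, h]
  simp only [tang, inner_sub_left, inner_sub_right]
  ring

lemma eq_of_tang_eq_zero (hl : 0 < l) (hv : Pinched l L v) {x z : En n} (h : tang v x z = 0) :
    z = x := by
  by_contra hne
  set ξ := z - x with hξ
  have hξ0 : ξ ≠ 0 := sub_ne_zero.2 hne
  set V := tang v x with hV
  have hVp : Pinched l L V := hv.tang x
  have hnn : ∀ y, 0 ≤ V y := tang_nonneg hv x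
  have hseg : ∀ s ∈ Icc (0:ℝ) 1, V (x + s • ξ) = 0 := by
    intro s hs
    refine le_antisymm ?_ (hnn _)
    have h1 := hVp.convexOn.2 (mem_univ x) (mem_univ z) (sub_nonneg.2 hs.2) hs.1 (by ring)
    have h2 : (1 - s) • x + s • z = x + s • ξ := by
      rw [hξ, smul_sub, sub_smul, one_smul]; abel
    have h3 : V x = 0 := tang_self v x
    rw [h2, h3, h] at h1
    simpa using h1
  have hgrad : ∀ s ∈ Icc (0:ℝ) 1, fderiv ℝ V (x + s • ξ) = 0 := by
    intro s hs
    have : IsLocalMin V (x + s • ξ) := Eventually.of_forall fun y => by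
      rw [hseg s hs]; exact hnn y
    exact this.fderiv_eq_zero
  have h1 : DifferentiableAt ℝ (fderiv ℝ V) (x + (0:ℝ) • ξ) :=
    ((hVp.contDiff.fderiv_right (m := 1) (by norm_num)).differentiable (by norm_num)) _
  have h2 : HasDerivAt (fun s : ℝ => x + s • ξ) ξ 0 := by
    simpa using ((hasDerivAt_id (0:ℝ)).smul_const ξ).const_add x
  have h3 := h1.hasFDerivAt.comp_hasDerivAt (0:ℝ) h2
  simp only [zero_smul, add_zero] at h3
  have h4 : HasDerivWithinAt (fderiv ℝ V ∘ fun s : ℝ => x + s • ξ) 0 (Icc 0 1) 0 := by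
    refine (hasDerivWithinAt_const (0:ℝ) (Icc 0 1) (0 : En n →L[ℝ] ℝ)).congr (fun s hs => ?_) ?_
    · exact hgrad s hs
    · exact hgrad 0 (by simp)
  have h5 : fderiv ℝ (fderiv ℝ V) x ξ = 0 :=
    (uniqueDiffOn_Icc (zero_lt_one' ℝ) 0 (by simp)).eq_deriv _ h3.hasDerivWithinAt h4
  have h6 := fderiv_fderiv_eq_dotProduct V x ξ ξ
  rw [h5] at h6
  have h7 := (hVp.posDef hl x).dotProduct_mulVec_pos (x := (ξ : Fin n → ℝ)) (by
    intro h0; apply hξ0; ext i; exact congrFun h0 i)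
  simp at h6 h7
  linarith

lemma gradient_injective (hl : 0 < l) (hv : Pinched l L v) :
    Function.Injective (gradient v) := by
  intro x y h
  have h1 := tang_nonneg hv x y
  have h2 := tang_nonneg hv y x
  refine (eq_of_tang_eq_zero hl hv (x := x) (z := y) ?_).symm
  simp only [tang] at *
  rw [h] at *
  simp only [inner_sub_right] at *
  linarith

lemma volume_gradient_image_le {v : En n → ℝ} (hv : ContDiff ℝ 2 v) {Γ : Set (En n)}
    (hΓ : MeasurableSet Γ) {D : ℝ} (hD : ∀ x ∈ Γ, |(hess v x).det| ≤ D) :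
    volume (gradient v '' Γ) ≤ ENNReal.ofReal D * volume Γ := by
  choose H hH hdet using fun x => exists_hasFDerivAt_gradient hv x
  refine (addHaar_image_le_lintegral_abs_det_fderiv volume hΓ
    (fun x _ => (hH x).hasFDerivWithinAt)).trans ?_
  rw [← setLIntegral_const]
  refine setLIntegral_mono measurable_const fun x hx => ENNReal.ofReal_le_ofReal ?_
  rw [hdet]; exact hD x hx

lemma le_volume_gradient_image (hl : 0 < l) (hv : Pinched l L v) {Γ : Set (En n)}
    (hΓ : MeasurableSet Γ) :
    ENNReal.ofReal l * volume Γ ≤ volume (gradient v '' Γ) := by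
  choose H hH hdet using fun x => exists_hasFDerivAt_gradient hv.contDiff x
  rw [← lintegral_abs_det_fderiv_eq_addHaar_image volume hΓ
    (fun x _ => (hH x).hasFDerivWithinAt) (gradient_injective hl hv).injOn, ← setLIntegral_const]
  refine setLIntegral_mono' hΓ fun x hx => ENNReal.ofReal_le_ofReal ?_
  rw [hdet]; exact (hv.le_det x).trans (le_abs_self _)

lemma convex_sublevel (hv : Pinched l L v) (h : ℝ) : Convex ℝ {x | v x ≤ h} := by
  simpa using hv.convexOn.convex_le h

lemma isClosed_sublevel (hv : Pinched l L v) (h : ℝ) : IsClosed {x | v x ≤ h} :=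
  isClosed_le hv.continuous continuous_const

end Pinched

section Sublevels

open Filter Topology
variable {n : ℕ} {l L : ℝ} {v V : En n → ℝ}

lemma le_on_simplex (hV : Pinched l L V) {h : ℝ} {q₀ : En n} {M : Matrix (Fin n) (Fin n) ℝ}
    (h0 : V q₀ ≤ h) (hi : ∀ i, V (q₀ + lin M (EuclideanSpace.single i 1)) ≤ h) {y : En n}
    (hy : ∀ i, 0 ≤ y i) (hsum : ∑ i, y i ≤ 1) : V (q₀ + lin M y) ≤ h := by
  have hy' : y = ∑ i, y i • EuclideanSpace.single i (1 : ℝ) := by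
    simpa using ((EuclideanSpace.basisFun (Fin n) ℝ).sum_repr y).symm
  have h1 := (convex_sublevel hV h).sum_mem (t := (Finset.univ : Finset (Option (Fin n))))
    (w := fun o => o.elim (1 - ∑ i, y i) fun i => y i)
    (z := fun o => o.elim q₀ fun i => q₀ + lin M (EuclideanSpace.single i 1))
    (by rintro (_ | i) _ <;> simp [hsum, hy])
    (by simp [Fintype.sum_option])
    (by rintro (_ | i) _ <;> simp [h0, hi])
  have h2 : ∑ o : Option (Fin n), (o.elim (1 - ∑ i, y i) fun i => y i : ℝ) •
      (o.elim q₀ fun i => q₀ + lin M (EuclideanSpace.single i 1) : En n) = q₀ + lin M y := by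
    rw [Fintype.sum_option]
    conv_rhs => rw [hy']
    simp only [Option.elim, smul_add, Finset.sum_add_distrib, ← Finset.sum_smul, sub_smul,
      one_smul, map_sum, map_smul]
    abel
  rw [h2] at h1
  exact h1

/-- A nonnegative convex function with determinant bounded below that is at most `h` on a simplex
forces the simplex to be small. -/
lemma det_barrier (hl : 0 < l) (hV : Pinched l L V) (hnn : ∀ x, 0 ≤ V x) {h : ℝ} (hh : 0 < h)
    {q₀ : En n} {M : Matrix (Fin n) (Fin n) ℝ} (hM : M.det ≠ 0) (h0 : V q₀ ≤ h)
    (hi : ∀ i, V (q₀ + lin M (EuclideanSpace.single i 1)) ≤ h) :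
    l * M.det ^ 2 ≤ (32 * (n + 1) ^ 2 * h) ^ n := by
  set r : ℝ := 1 / (4 * (n + 1)) with hr
  have hr0 : 0 < r := by positivity
  set c : En n := WithLp.toLp 2 (fun _ => 3 * r / 2) with hc
  set Γ : Set (En n) := (fun y => (q₀ + lin M c) + y) '' (lin M '' box n (r / 2)) with hΓ
  have hcont : Continuous (lin M) := (lin M).continuous_of_finiteDimensional
  have hΓm : MeasurableSet Γ :=
    (((isCompact_box n (r/2)).image hcont).image (by fun_prop)).isClosed.measurableSet
  have hvol : volume Γ = ENNReal.ofReal (|M.det| * r ^ n) := by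
    rw [hΓ, volume_image_add_left, volume_lin_image_box _ (by positivity)]
    congr 3; ring
  have hsub : gradient V '' Γ ⊆ lin M.transpose ⁻¹' box n (h / r) := by
    rintro _ ⟨_, ⟨_, ⟨y, hy, rfl⟩, rfl⟩, rfl⟩
    have hb : ∀ j, r ≤ c j + y j ∧ c j + y j ≤ 2 * r := by
      intro j
      have := abs_le.1 (hy j)
      simp only [hc]
      constructor <;> linarith
    have hn : (n : ℝ) * (2 * r) ≤ 1 / 2 := by
      rw [hr]; field_simp; nlinarith
    have hsum : ∑ j, (c j + y j) ≤ 1 / 2 := by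
      refine le_trans ?_ hn
      calc ∑ j, (c j + y j) ≤ ∑ _j : Fin n, 2 * r := Finset.sum_le_sum fun j _ => (hb j).2
        _ = _ := by simp
    have hr4 : r ≤ 1 / 4 := by
      rw [hr, div_le_div_iff₀ (by positivity) (by norm_num)]
      have : (0:ℝ) ≤ n := Nat.cast_nonneg n
      linarith
    have key : ∀ i (σ : ℝ), |σ| = r →
        inner ℝ (gradient V (q₀ + lin M c + lin M y)) (lin M (σ • EuclideanSpace.single i 1)) ≤ h := by
      intro i σ hσ
      have hσ' := abs_le.1 hσ.le
      have h1 := le_of_convexOn hV.convexOn hV.differentiable (q₀ + lin M c + lin M y)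
        (q₀ + lin M (c + y + σ • EuclideanSpace.single i 1))
      have h2 : q₀ + lin M (c + y + σ • EuclideanSpace.single i 1) - (q₀ + lin M c + lin M y)
          = lin M (σ • EuclideanSpace.single i 1) := by
        simp only [map_add]; abel
      rw [h2] at h1
      have h3 : V (q₀ + lin M (c + y + σ • EuclideanSpace.single i 1)) ≤ h := by
        refine le_on_simplex hV h0 hi (fun j => ?_) ?_
        · have := (hb j).1
          by_cases hj : j = i
          · subst hj; simp; linarith
          · simp [hj]; linarith
        · simp only [PiLp.add_apply, PiLp.smul_apply, Finset.sum_add_distrib (g := fun j =>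
            (σ • (EuclideanSpace.single i (1:ℝ) : En n) j))]
          simp
          simp at hsum
          linarith
      have := hnn (q₀ + lin M c + lin M y)
      linarith
    intro i
    have hpos := key i r (abs_of_pos hr0)
    have hneg := key i (-r) (by rw [abs_neg, abs_of_pos hr0])
    rw [inner_lin] at hpos hneg
    simp at hpos hneg
    rw [abs_le, le_div_iff₀ hr0, ← neg_div, div_le_iff₀ hr0]
    constructor <;> linarith
  have h1 := (le_volume_gradient_image hl hV hΓm).trans (measure_mono hsub)
  rw [hvol, volume_lin_preimage_box (by rwa [Matrix.det_transpose]) (by positivity),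
    ← ENNReal.ofReal_mul hl.le, ENNReal.ofReal_le_ofReal_iff (by positivity),
    Matrix.det_transpose, le_div_iff₀ (abs_pos.2 hM)] at h1
  have h2 : l * M.det ^ 2 * r ^ n ≤ (2 * (h / r)) ^ n := by
    rw [← sq_abs]; nlinarith
  have h3 : (2 * (h / r)) ^ n = (32 * (n + 1) ^ 2 * h) ^ n * r ^ n := by
    rw [← mul_pow]; congr 1; rw [hr]; field_simp; ring
  rw [h3] at h2
  exact le_of_mul_le_mul_right h2 (by positivity)

/-- Slopes of planes touching from below inside a sublevel set. -/
lemma mem_gradient_image_of_lt (hV : Differentiable ℝ V) {H : ℝ}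
    (hcpt : IsCompact {x | V x ≤ H}) {y p : En n} (hy : V y ≤ H)
    (hb : ∀ q, V q = H → V y < V q - inner ℝ p (q - y)) :
    p ∈ gradient V '' {x | V x ≤ H} := by
  obtain ⟨q, hq, hmin⟩ := hcpt.exists_isMinOn (f := fun q => V q - inner ℝ p (q - y)) ⟨y, hy⟩
    (by have := hV.continuous; fun_prop)
  have hmy := hmin hy
  simp only [mem_ofPred_eq, sub_self, inner_zero_right, sub_zero] at hmy
  have hlt : V q < H := by
    refine lt_of_le_of_ne hq fun h => ?_
    have := hb q h
    linarith
  refine ⟨q, hq, ?_⟩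
  have hnhds : {x | V x ≤ H} ∈ 𝓝 q := by
    filter_upwards [(isOpen_lt hV.continuous continuous_const).mem_nhds hlt] with x hx
    exact le_of_lt hx
  have hloc : IsLocalMin (fun q => V q + (-1) * (0 + inner ℝ p (q - y))) q := by
    filter_upwards [hnhds] with x hx
    have := hmin hx
    simp only [mem_ofPred_eq] at this
    linarith
  have := gradient_eq_zero_of_isLocalMin hloc
  rw [gradient_add_affine hV] at this
  exact sub_eq_zero.1 this

end Sublevels

section SectionVolume

open Filter Topology
variable {n : ℕ} {l L : ℝ} {v V : En n → ℝ}

/-- Box coordinates adapted to a compact sublevel set. -/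
lemma exists_section_box (hl : 0 < l) (hV : Pinched l L V) (hnn : ∀ x, 0 ≤ V x) {h : ℝ}
    (hh : 0 < h) (hcpt : IsCompact {x | V x ≤ h}) {y : En n} (hy : V y < h) :
    ∃ (q₀ : En n) (M : Matrix (Fin n) (Fin n) ℝ), M.det ≠ 0 ∧
      l * M.det ^ 2 ≤ (32 * (n + 1) ^ 2 * h) ^ n ∧
      ∀ q, V q ≤ h → ∃ z ∈ box n 1, q = q₀ + lin M z := by
  have hintr : (interior {x | V x ≤ h}).Nonempty := by
    refine ⟨y, mem_interior.2 ⟨{x | V x < h}, fun x (hx : V x < h) => (hx.le : V x ≤ h),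
      isOpen_lt hV.continuous continuous_const, hy⟩⟩
  obtain ⟨q₀, hq₀, M, hM, hMi, hbox⟩ := exists_box_coordinates hcpt hintr
  exact ⟨q₀, M, hM, det_barrier hl hV hnn hh hM hq₀ hMi, hbox⟩

lemma volume_le_of_box {S : Set (En n)} {q₀ : En n} {M : Matrix (Fin n) (Fin n) ℝ}
    (hbox : ∀ q ∈ S, ∃ z ∈ box n 1, q = q₀ + lin M z) :
    volume S ≤ ENNReal.ofReal (|M.det| * 2 ^ n) := by
  have hsub : S ⊆ (fun y => q₀ + y) '' (lin M '' box n 1) := by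
    intro q hq
    obtain ⟨z, hz, rfl⟩ := hbox q hq
    exact ⟨_, ⟨z, hz, rfl⟩, rfl⟩
  refine (measure_mono hsub).trans ?_
  rw [volume_image_add_left, volume_lin_image_box _ zero_le_one, mul_one]

lemma abs_inner_le_of_box {S : Set (En n)} {q₀ : En n} {M : Matrix (Fin n) (Fin n) ℝ}
    (hbox : ∀ q ∈ S, ∃ z ∈ box n 1, q = q₀ + lin M z) {p : En n} {ρ : ℝ}
    (hp : lin M.transpose p ∈ box n ρ) {q y : En n} (hq : q ∈ S) (hy : y ∈ S) :
    |inner ℝ p (q - y)| ≤ 2 * n * ρ := by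
  obtain ⟨z, hz, rfl⟩ := hbox q hq
  obtain ⟨z', hz', rfl⟩ := hbox y hy
  have h1 : q₀ + lin M z - (q₀ + lin M z') = lin M (z - z') := by rw [map_sub]; abel
  rw [h1, inner_lin]
  calc |∑ i, lin M.transpose p i * (z - z') i|
      ≤ ∑ i, |lin M.transpose p i * (z - z') i| := Finset.abs_sum_le_sum_abs _ _
    _ ≤ ∑ _i : Fin n, ρ * 2 := by
        refine Finset.sum_le_sum fun i _ => ?_
        rw [abs_mul]
        have h2 := abs_le.1 (hz i)
        have h3 := abs_le.1 (hz' i)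
        have h4 : |(z - z') i| ≤ 2 := by
          rw [PiLp.sub_apply, abs_le]; constructor <;> linarith
        exact mul_le_mul (hp i) h4 (abs_nonneg _) ((abs_nonneg _).trans (hp i))
    _ = 2 * n * ρ := by simp; ring

/-- All slopes close to the segment from `0` to half the gradient are attained. -/
lemma slope_mem_gradient_image (hV : Pinched l L V) (hnn : ∀ x, 0 ≤ V x)
    {h : ℝ} (hh : 0 < h) (hcpt : IsCompact {x | V x ≤ 2 * h}) {y : En n} (hy : V y ≤ h)
    {q₀ : En n} {M : Matrix (Fin n) (Fin n) ℝ}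
    (hbox : ∀ q, V q ≤ 2 * h → ∃ z ∈ box n 1, q = q₀ + lin M z)
    {θ : ℝ} (hθ : 0 ≤ θ) (hθ' : θ ≤ 1 / 2) {p : En n}
    (hp : lin M.transpose p ∈ box n (h / (8 * (n + 1)))) :
    θ • gradient V y + p ∈ gradient V '' {x | V x ≤ 2 * h} := by
  refine mem_gradient_image_of_lt hV.differentiable hcpt (y := y) (by linarith) fun q hq => ?_
  have h1 := abs_inner_le_of_box (S := {x | V x ≤ 2 * h}) hbox hp (q := q) (y := y)
    hq.le (show V y ≤ 2 * h by linarith)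
  have h2 : 2 * (n:ℝ) * (h / (8 * (n + 1))) ≤ h / 4 := by
    rw [mul_div_assoc', div_le_div_iff₀ (by positivity) (by norm_num)]
    nlinarith
  have h3 := le_of_convexOn hV.convexOn hV.differentiable y q
  have h4 := abs_le.1 h1
  have h5 := hnn y
  rw [inner_add_left, real_inner_smul_left, hq]
  rw [hq] at h3
  have h6 : θ * inner ℝ (gradient V y) (q - y) ≤ θ * (2 * h - V y) :=
    mul_le_mul_of_nonneg_left (by linarith) hθ
  have h7 : θ * (2 * h - V y) ≤ 1 / 2 * (2 * h - V y) :=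
    mul_le_mul_of_nonneg_right hθ' (by linarith)
  linarith

lemma volume_gradient_sublevel_le (hl : 0 < l) (hV : Pinched l L V) (H : ℝ) :
    volume (gradient V '' {x | V x ≤ H}) ≤ ENNReal.ofReal L * volume {x | V x ≤ H} :=
  volume_gradient_image_le hV.contDiff (isClosed_sublevel hV H).measurableSet fun x _ => by
    rw [abs_of_pos (hl.trans_le (hV.le_det x))]; exact hV.det_le x

/-- Lower volume bound for sublevel sets. -/
lemma le_volume_sublevel (hl : 0 < l) (hV : Pinched l L V) (hnn : ∀ x, 0 ≤ V x)
    {h : ℝ} (hh : 0 < h) (hcpt : IsCompact {x | V x ≤ 2 * h}) {y : En n} (hy : V y ≤ h)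
    {q₀ : En n} {M : Matrix (Fin n) (Fin n) ℝ} (hM : M.det ≠ 0)
    (hbox : ∀ q, V q ≤ 2 * h → ∃ z ∈ box n 1, q = q₀ + lin M z) :
    ENNReal.ofReal ((h / (4 * (n + 1))) ^ n / |M.det|)
      ≤ ENNReal.ofReal L * volume {x | V x ≤ 2 * h} := by
  have hsub : lin M.transpose ⁻¹' box n (h / (8 * (n + 1))) ⊆ gradient V '' {x | V x ≤ 2 * h} := by
    intro p hp
    have := slope_mem_gradient_image hV hnn hh hcpt hy hbox le_rfl (by norm_num) hp
    simpa using this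
  refine le_trans (le_of_eq ?_) ((measure_mono hsub).trans (volume_gradient_sublevel_le hl hV _))
  rw [volume_lin_preimage_box (by rwa [Matrix.det_transpose]) (by positivity),
    Matrix.det_transpose]
  congr 3; field_simp; ring

/-- The gradient at a point of a section is controlled by the section. -/
lemma exists_gradient_bound (n : ℕ) (L : ℝ) (hl : 0 < l) : ∃ C : ℝ, 1 ≤ C ∧
    ∀ V : En n → ℝ, Pinched l L V → (∀ x, 0 ≤ V x) → ∀ h : ℝ, 0 < h →
      IsCompact {x | V x ≤ 2 * h} → ∀ y z, V y ≤ h → V z ≤ 2 * h →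
      |inner ℝ (gradient V y) (z - y)| ≤ C * h := by
  set C₀ : ℝ := L * ((64 * (n + 1) ^ 2) ^ n / l) * (8 * (n + 1)) ^ n with hC₀
  set J : ℕ := ⌊C₀⌋₊ + 1 with hJ
  have hJC : C₀ < J := by rw [hJ]; push_cast; exact Nat.lt_floor_add_one C₀
  have hJ1 : (1:ℝ) ≤ J := by rw [hJ]; push_cast; linarith [Nat.cast_nonneg (α := ℝ) ⌊C₀⌋₊]
  refine ⟨J, hJ1, fun V hV hnn h hh hcpt y z hy hz => ?_⟩
  obtain ⟨q₀, M, hM, hdet, hbox⟩ := exists_section_box hl hV hnn (by linarith : 0 < 2 * h) hcpt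
    (y := y) (by linarith)
  have hL : 0 ≤ L := hl.le.trans ((hV.le_det 0).trans (hV.det_le 0))
  set ρ : ℝ := h / (8 * (n + 1)) with hρ
  have hρ0 : 0 < ρ := by positivity
  have hMt : M.transpose.det ≠ 0 := by rwa [Matrix.det_transpose]
  have ha : lin M.transpose (gradient V y) ∈ box n (4 * J * ρ) := by
    intro i
    by_contra! hai
    have hvol := mul_volume_le_of_disjoint_translates (n := n)
      (K := lin M.transpose ⁻¹' box n ρ) (W := gradient V '' {x | V x ≤ 2 * h})
      ((isClosed_box n ρ).preimage (lin M.transpose).continuous_of_finiteDimensional).measurableSet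
      (fun k => ((k:ℝ) / (2 * J)) • gradient V y) J ?_ ?_
    · have h1 := hvol.trans ((volume_gradient_sublevel_le hl hV _).trans
        (mul_le_mul_right (volume_le_of_box hbox) _))
      rw [volume_lin_preimage_box hMt hρ0.le, Matrix.det_transpose, ← ENNReal.ofReal_mul hL,
        ← ENNReal.ofReal_natCast, ← ENNReal.ofReal_mul (by positivity),
        ENNReal.ofReal_le_ofReal_iff (by positivity), mul_div_assoc',
        div_le_iff₀ (abs_pos.2 hM)] at h1
      have h2 : (J:ℝ) * (2 * ρ) ^ n ≤ L * 2 ^ n * M.det ^ 2 := by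
        rw [← sq_abs]; nlinarith
      have h3 : M.det ^ 2 ≤ ((64 * (n + 1) ^ 2) ^ n / l) * h ^ n := by
        rw [div_mul_eq_mul_div, le_div_iff₀ hl, ← mul_pow]
        calc M.det ^ 2 * l = l * M.det ^ 2 := by ring
          _ ≤ _ := hdet
          _ = _ := by congr 1; ring
      have h4 : L * 2 ^ n * M.det ^ 2 ≤ C₀ * (2 * ρ) ^ n := by
        calc L * 2 ^ n * M.det ^ 2 ≤ L * 2 ^ n * (((64 * (n + 1) ^ 2) ^ n / l) * h ^ n) := by
              gcongr
          _ = C₀ * (2 * ρ) ^ n := by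
              rw [hC₀, mul_pow 2 ρ, show h = (8 * (n + 1)) * ρ by rw [hρ]; field_simp,
                mul_pow (8 * ((n:ℝ) + 1)) ρ]
              ring
      have h5 : (0:ℝ) < (2 * ρ) ^ n := by positivity
      have h6 := h2.trans h4
      have := le_of_mul_le_mul_right h6 h5
      linarith
    · intro j hj k hk hjk p hp q hq heq
      have hpi := abs_le.1 (hp i)
      have hqi := abs_le.1 (hq i)
      have h1 : (((j:ℝ) - k) / (2 * J)) * lin M.transpose (gradient V y) i
          = lin M.transpose q i - lin M.transpose p i := by
        have h2 := congrArg (fun w => lin M.transpose w i) heq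
        simp only [map_add, map_smul, PiLp.add_apply, PiLp.smul_apply, smul_eq_mul] at h2
        linear_combination h2
      have h3 : (1:ℝ) ≤ |(j:ℝ) - k| := by
        have : (1:ℤ) ≤ |(j:ℤ) - k| := Int.one_le_abs (by omega)
        exact_mod_cast this
      have h4 : |(((j:ℝ) - k) / (2 * J)) * lin M.transpose (gradient V y) i| ≤ 2 * ρ := by
        rw [h1, abs_le]; constructor <;> linarith
      rw [abs_mul, abs_div, abs_of_pos (by positivity : (0:ℝ) < 2 * J)] at h4
      have h5 : 1 / (2 * (J:ℝ)) * (4 * J * ρ) < |(j:ℝ) - k| / (2 * J) *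
          |lin M.transpose (gradient V y) i| := by
        refine mul_lt_mul' (by gcongr) hai (by positivity) (by positivity)
      have h6 : 1 / (2 * (J:ℝ)) * (4 * J * ρ) = 2 * ρ := by field_simp; ring
      linarith
    · intro k hk p hp
      refine slope_mem_gradient_image hV hnn hh hcpt hy hbox (by positivity) ?_ hp
      have : (k:ℝ) ≤ J := by exact_mod_cast hk.le
      rw [div_le_div_iff₀ (by positivity) (by norm_num)]
      linarith
  have h1 := abs_inner_le_of_box (S := {x | V x ≤ 2 * h}) hbox ha (q := z) (y := y)
    hz (show V y ≤ 2 * h by linarith)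
  refine h1.trans ?_
  rw [hρ]
  have : (2:ℝ) * n * (4 * J * (h / (8 * (n + 1)))) = J * h * (n / (n + 1)) := by
    field_simp; ring
  rw [this]
  have h2 : (n:ℝ) / (n + 1) ≤ 1 := by rw [div_le_one (by positivity)]; linarith
  nlinarith [mul_nonneg (by positivity : (0:ℝ) ≤ J) hh.le]

end SectionVolume

section Growth

open Filter Topology
variable {n : ℕ} {l L : ℝ} {v V : En n → ℝ}

/-- A strictly convex function with a minimum grows at least linearly. -/
lemma exists_linear_growth (hl : 0 < l) (hv : Pinched l L v) (x : En n) :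
    ∃ c : ℝ, 0 < c ∧ ∀ z, 1 ≤ ‖z - x‖ → c * ‖z - x‖ ≤ tang v x z := by
  have hcont : Continuous (tang v x) := (hv.tang x).continuous
  rcases (Metric.sphere x 1).eq_empty_or_nonempty with hemp | hne
  · refine ⟨1, one_pos, fun z hz => ?_⟩
    exfalso
    have hz0 : ‖z - x‖ ≠ 0 := by intro h; rw [h] at hz; linarith
    have : x + (‖z - x‖)⁻¹ • (z - x) ∈ Metric.sphere x 1 := by
      simp [norm_smul, hz0]
    rw [hemp] at this
    exact this
  · obtain ⟨y, hy, hmin⟩ := (isCompact_sphere x 1).exists_isMinOn hne hcont.continuousOn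
    refine ⟨tang v x y, ?_, fun z hz => ?_⟩
    · refine lt_of_le_of_ne (tang_nonneg hv x y) fun h => ?_
      have := eq_of_tang_eq_zero hl hv h.symm
      simp [this] at hy
    · set r := ‖z - x‖ with hr
      have hr0 : 0 < r := by linarith
      have hmem : x + r⁻¹ • (z - x) ∈ Metric.sphere x 1 := by
        simp [norm_smul, abs_of_pos hr0, ← hr, hr0.ne']
      have h1 := hmin hmem
      have h2 := (hv.tang x).convexOn.2 (mem_univ x) (mem_univ z)
        (sub_nonneg.2 (inv_le_one_of_one_le₀ hz)) (inv_nonneg.2 hr0.le) (by ring)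
      have h3 : (1 - r⁻¹) • x + r⁻¹ • z = x + r⁻¹ • (z - x) := by
        rw [smul_sub, sub_smul, one_smul]; abel
      rw [h3, tang_self, smul_zero, zero_add, smul_eq_mul] at h2
      have h4 : tang v x y ≤ r⁻¹ * tang v x z := le_trans h1 h2
      rw [inv_mul_eq_div, le_div_iff₀ hr0] at h4
      exact h4

lemma isCompact_section (hl : 0 < l) (hv : Pinched l L v) (x : En n) (h : ℝ) :
    IsCompact {z | tang v x z ≤ h} := by
  obtain ⟨c, hc, hgrow⟩ := exists_linear_growth hl hv x
  refine Metric.isCompact_of_isClosed_isBounded (isClosed_sublevel (hv.tang x) h) ?_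
  refine (Metric.isBounded_closedBall (x := x) (r := max 1 (h / c))).subset fun z hz => ?_
  rw [Metric.mem_closedBall, dist_eq_norm]
  by_contra! hlt
  have h1 : 1 < ‖z - x‖ := (le_max_left _ _).trans_lt hlt
  have h2 : h / c < ‖z - x‖ := (le_max_right _ _).trans_lt hlt
  have h3 := hgrow z h1.le
  rw [div_lt_iff₀ hc] at h2
  have h4 : tang v x z ≤ h := hz
  linarith

lemma exists_engulfing (n : ℕ) (L : ℝ) (hl : 0 < l) : ∃ C : ℝ, 1 ≤ C ∧
    ∀ v : En n → ℝ, Pinched l L v → ∀ (h : ℝ) (x y z : En n), tang v x y ≤ h → tang v x z ≤ h →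
      tang v y z ≤ C * h := by
  obtain ⟨C, hC, hgrad⟩ := exists_gradient_bound n L hl
  refine ⟨C + 1, by linarith, fun v hv h x y z hy hz => ?_⟩
  have h0 : 0 ≤ h := (tang_nonneg hv x y).trans hy
  rcases h0.eq_or_lt with h0 | h0
  · subst h0
    have h1 := eq_of_tang_eq_zero hl hv (le_antisymm hy (tang_nonneg hv x y))
    have h2 := eq_of_tang_eq_zero hl hv (le_antisymm hz (tang_nonneg hv x z))
    subst h1; subst h2
    simp [tang_self]
  · have h1 := hgrad _ (hv.tang x) (tang_nonneg hv x) h h0 (isCompact_section hl hv x _) y z hy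
      (by linarith)
    have h2 := tang_tang hv x y z
    have h3 := tang_nonneg hv x y
    rw [← h2, tang]
    have := abs_le.1 h1
    linarith

lemma exists_growth (n : ℕ) (L : ℝ) (hl : 0 < l) : ∃ k : ℕ,
    ∀ v : En n → ℝ, Pinched l L v → ∀ (x ξ : En n) (σ : ℝ), 1 ≤ σ →
      tang v x (x + σ • ξ) ≤ σ ^ k * tang v x (x + ξ) := by
  obtain ⟨C, hC, hgrad⟩ := exists_gradient_bound n L hl
  refine ⟨⌈C⌉₊, fun v hv x ξ σ hσ => ?_⟩
  set k := ⌈C⌉₊ with hk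
  have hkC : C ≤ k := Nat.le_ceil C
  set V := tang v x with hV
  have hVp : Pinched l L V := hv.tang x
  set φ : ℝ → ℝ := fun s => V (x + s • ξ) with hφ
  have hφd : ∀ s, HasDerivAt φ (fderiv ℝ V (x + s • ξ) ξ) s :=
    fun s => hasDerivAt_line hVp.differentiable x ξ s
  have hle : ∀ s, 0 < s → s * fderiv ℝ V (x + s • ξ) ξ ≤ k * φ s := by
    intro s hs
    rcases (tang_nonneg hv x (x + s • ξ)).eq_or_lt with h0 | h0
    · have h1 : IsLocalMin V (x + s • ξ) := Eventually.of_forall fun y => by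
        rw [hV, ← h0]; exact tang_nonneg hv x y
      rw [h1.fderiv_eq_zero]
      have : φ s = 0 := h0.symm
      simp [this]
    · have h1 := hgrad V hVp (tang_nonneg hv x) (φ s) h0 (isCompact_section hl hv x _)
        (x + s • ξ) x le_rfl (by rw [hV, tang_self]; linarith)
      have h2 : x - (x + s • ξ) = (-s) • ξ := by rw [neg_smul]; abel
      rw [h2, inner_gradient, map_smul, smul_eq_mul] at h1
      have h3 := (abs_le.1 h1).1
      have h4 : C * φ s ≤ k * φ s := mul_le_mul_of_nonneg_right hkC h0.le
      linarith
  have hg : ∀ s ∈ Ici (1:ℝ), HasDerivAt (fun s => φ s / s ^ k)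
      ((fderiv ℝ V (x + s • ξ) ξ * s ^ k - φ s * (k * s ^ (k - 1))) / (s ^ k) ^ 2) s := by
    intro s hs
    have hs0 : (s:ℝ) ≠ 0 := by have : (1:ℝ) ≤ s := hs; positivity
    exact (hφd s).div (hasDerivAt_pow k s) (pow_ne_zero k hs0)
  have hanti : AntitoneOn (fun s => φ s / s ^ k) (Ici (1:ℝ)) := by
    refine antitoneOn_of_deriv_nonpos (convex_Ici 1)
      (fun s hs => (hg s hs).continuousAt.continuousWithinAt)
      (fun s hs => (hg s (interior_subset hs)).differentiableAt.differentiableWithinAt)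
      fun s hs => ?_
    rw [(hg s (interior_subset hs)).deriv]
    have hs1 : (1:ℝ) ≤ s := interior_subset hs
    have hs0 : 0 < s := by linarith
    refine div_nonpos_of_nonpos_of_nonneg ?_ (by positivity)
    have h1 := hle s hs0
    rcases Nat.eq_zero_or_pos k with hk0 | hk0
    · rw [hk0] at hkC; norm_num at hkC; linarith
    · obtain ⟨m, hm⟩ : ∃ m, k = m + 1 := ⟨k - 1, by omega⟩
      rw [hm] at h1 ⊢
      simp only [Nat.add_sub_cancel]
      have h2 : 0 < s ^ m := by positivity
      rw [pow_succ]
      nlinarith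
  have h1 := hanti (mem_Ici.2 le_rfl) (mem_Ici.2 hσ) hσ
  have hσk : 0 < σ ^ k := by positivity
  simp only [one_pow, div_one] at h1
  rw [div_le_iff₀ hσk] at h1
  simp only [hφ, one_smul] at h1
  linarith

lemma exists_balance (n : ℕ) (L : ℝ) (hl : 0 < l) : ∃ C : ℝ, 1 ≤ C ∧
    ∀ v : En n → ℝ, Pinched l L v → ∀ (x ξ : En n),
      tang v x (x - ξ) ≤ C * tang v x (x + ξ) := by
  obtain ⟨C, hC, heng⟩ := exists_engulfing n L hl
  obtain ⟨k, hk⟩ := exists_growth n L hl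
  have h2k : (1:ℝ) ≤ 2 ^ k := one_le_pow₀ (by norm_num)
  refine ⟨C * (2 ^ k * C), by nlinarith [mul_le_mul h2k hC zero_le_one (by positivity)],
    fun v hv x ξ => ?_⟩
  set h := tang v x (x + ξ) with hh
  have h0 : 0 ≤ h := tang_nonneg hv _ _
  have h1 : tang v (x + ξ) x ≤ C * h :=
    heng v hv h x (x + ξ) x le_rfl (by rw [tang_self]; exact h0)
  have h2 : tang v (x + ξ) (x - ξ) ≤ 2 ^ k * (C * h) := by
    have h3 := hk v hv (x + ξ) (-ξ) 2 (by norm_num)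
    have e1 : x + ξ + (2:ℝ) • -ξ = x - ξ := by rw [two_smul]; abel
    have e2 : x + ξ + -ξ = x := by abel
    rw [e1, e2] at h3
    exact h3.trans (mul_le_mul_of_nonneg_left h1 (by positivity))
  have h4 : C * h ≤ 2 ^ k * (C * h) := le_mul_of_one_le_left (by positivity) h2k
  have := heng v hv (2 ^ k * (C * h)) (x + ξ) x (x - ξ) (h1.trans h4) h2
  linarith

end Growth

section Rise

open Filter Topology

/-- If a family of functions of one variable rises by `c₀` on average, has right upper derivatives at
most `C`, and at most `0` off the set `P τ`, then `P τ` has large measure for some `τ`. -/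
lemma exists_lt_measure_of_rise {X : Type*} [MeasurableSpace X] (μ : Measure X) [IsFiniteMeasure μ]
    (g : X → ℝ → ℝ) {a b K B C c₀ v₀ : ℝ} (hab : a ≤ b) (hC : 0 ≤ C)
    (hmeas : ∀ τ ∈ Icc a b, Measurable fun p => g p τ)
    (hlip : ∀ p, ∀ σ ∈ Icc a b, ∀ τ ∈ Icc a b, |g p σ - g p τ| ≤ K * |σ - τ|)
    (hbdd : ∀ p, ∀ τ ∈ Icc a b, |g p τ| ≤ B)
    (P : ℝ → Set X) (hP : ∀ τ ∈ Ico a b, MeasurableSet (P τ))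
    (hle : ∀ p, ∀ τ ∈ Ico a b, ∀ η > 0, ∀ᶠ σ in 𝓝[>] τ, g p σ - g p τ ≤ (C + η) * (σ - τ))
    (hle₀ : ∀ τ ∈ Ico a b, ∀ p ∉ P τ, ∀ η > 0, ∀ᶠ σ in 𝓝[>] τ, g p σ - g p τ ≤ η * (σ - τ))
    (hrise : ∀ p, c₀ ≤ g p b - g p a) (hv₀ : C * v₀ * (b - a) < c₀ * μ.real univ) :
    ∃ τ ∈ Ico a b, v₀ < μ.real (P τ) := by
  by_contra! hcon
  have hintr : ∀ τ ∈ Icc a b, Integrable (fun p => g p τ) μ := fun τ hτ =>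
    Integrable.of_bound (hmeas τ hτ).aestronglyMeasurable B
      (Eventually.of_forall fun p => by simpa using hbdd p τ hτ)
  set G : ℝ → ℝ := fun τ => ∫ p, g p τ ∂μ with hG
  have hGlip : ∀ σ ∈ Icc a b, ∀ τ ∈ Icc a b, |G σ - G τ| ≤ (K * μ.real univ) * |σ - τ| := by
    intro σ hσ τ hτ
    simp only [hG]
    rw [← integral_sub (hintr σ hσ) (hintr τ hτ)]
    have := norm_integral_le_of_norm_le_const (μ := μ) (f := fun p => g p σ - g p τ)
      (C := K * |σ - τ|) (Eventually.of_forall fun p => by simpa using hlip p σ hσ τ hτ)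
    rw [Real.norm_eq_abs] at this
    linarith
  have hGcont : ContinuousOn G (Icc a b) := by
    refine (LipschitzOnWith.of_dist_le_mul (K := (K * μ.real univ).toNNReal) ?_).continuousOn
    intro σ hσ τ hτ
    rw [Real.dist_eq, Real.dist_eq]
    exact (hGlip σ hσ τ hτ).trans (mul_le_mul_of_nonneg_right (Real.le_coe_toNNReal _)
      (abs_nonneg _))
  have key : ∀ τ ∈ Ico a b, ∀ r, C * v₀ < r → ∃ᶠ σ in 𝓝[>] τ, slope G τ σ < r := by
    intro τ hτ r hr
    have hτ' : τ ∈ Icc a b := ⟨hτ.1, hτ.2.le⟩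
    set s : ℕ → ℝ := fun k => τ + (b - τ) / (k + 1) with hs
    have hbτ : 0 < b - τ := sub_pos.2 hτ.2
    have hs_gt : ∀ k, τ < s k := fun k => by
      have : 0 < (b - τ) / (k + 1) := by positivity
      simp only [hs]
      linarith
    have hs_mem : ∀ k, s k ∈ Icc a b := fun k => by
      refine ⟨hτ.1.trans (hs_gt k).le, ?_⟩
      simp only [hs]
      have : (b - τ) / (k + 1) ≤ b - τ := div_le_self hbτ.le (by linarith [Nat.cast_nonneg (α := ℝ) k])
      linarith
    have hs_lim : Tendsto s atTop (𝓝[>] τ) := by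
      refine tendsto_nhdsWithin_iff.2 ⟨?_, Eventually.of_forall hs_gt⟩
      have h1 := (tendsto_one_div_add_atTop_nhds_zero_nat (𝕜 := ℝ)).const_mul (b - τ)
      have h2 := h1.const_add τ
      simp only [mul_zero, add_zero] at h2
      refine h2.congr fun k => by simp only [hs]; ring
    set q : ℕ → X → ℝ := fun k p => (g p (s k) - g p τ) / (s k - τ) with hq
    have hqm : ∀ k, Measurable (q k) := fun k =>
      ((hmeas _ (hs_mem k)).sub (hmeas τ hτ')).div_const _
    have hqb : ∀ k p, |q k p| ≤ K := by
      intro k p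
      have h0 : 0 < s k - τ := sub_pos.2 (hs_gt k)
      rw [hq, abs_div, abs_of_pos h0, div_le_iff₀ h0]
      have := hlip p (s k) (hs_mem k) τ hτ'
      rwa [abs_of_pos h0] at this
    have hqi : ∀ k, Integrable (q k) μ := fun k =>
      Integrable.of_bound (hqm k).aestronglyMeasurable K
        (Eventually.of_forall fun p => by simpa using hqb k p)
    have hslope : ∀ k, slope G τ (s k) = ∫ p, q k p ∂μ := by
      intro k
      rw [slope_def_field]
      simp only [hq, hG]
      rw [integral_div, integral_sub (hintr _ (hs_mem k)) (hintr τ hτ')]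
    have hlim : limsup (fun k => ∫⁻ p, ENNReal.ofReal (q k p) ∂μ) atTop
        ≤ ENNReal.ofReal C * μ (P τ) := by
      refine (limsup_lintegral_le (fun _ => ENNReal.ofReal K) (fun k => (hqm k).ennreal_ofReal)
        (fun k => Eventually.of_forall fun p => ENNReal.ofReal_le_ofReal
          ((le_abs_self _).trans (hqb k p))) ?_).trans ?_
      · rw [lintegral_const]
        exact ENNReal.mul_ne_top ENNReal.ofReal_ne_top (measure_ne_top _ _)
      · rw [← lintegral_indicator_const (hP τ hτ)]
        refine lintegral_mono fun p => ?_
        have hev : ∀ D : ℝ, 0 ≤ D →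
            (∀ η > 0, ∀ᶠ σ in 𝓝[>] τ, g p σ - g p τ ≤ (D + η) * (σ - τ)) →
            limsup (fun k => ENNReal.ofReal (q k p)) atTop ≤ ENNReal.ofReal D := by
          intro D hD hη
          refine ENNReal.le_of_forall_pos_le_add fun ε hε _ => ?_
          refine limsup_le_of_le (by isBoundedDefault) ?_
          filter_upwards [hs_lim.eventually (hη ε (by exact_mod_cast hε))] with k hk
          rw [← ENNReal.ofReal_coe_nnreal, ← ENNReal.ofReal_add hD (by positivity)]
          refine ENNReal.ofReal_le_ofReal ?_
          rw [hq, div_le_iff₀ (sub_pos.2 (hs_gt k))]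
          exact hk
        by_cases hp : p ∈ P τ
        · rw [Set.indicator_of_mem hp]
          exact hev C hC (hle p τ hτ)
        · rw [Set.indicator_of_notMem hp]
          have := hev 0 le_rfl (by simpa using hle₀ τ hτ p hp)
          simpa using this
    have hlt : limsup (fun k => ∫⁻ p, ENNReal.ofReal (q k p) ∂μ) atTop < ENNReal.ofReal r := by
      refine hlim.trans_lt ?_
      have h1 : μ (P τ) = ENNReal.ofReal (μ.real (P τ)) := (ofReal_measureReal).symm
      rw [h1, ← ENNReal.ofReal_mul hC]
      have h2 : C * μ.real (P τ) ≤ C * v₀ := mul_le_mul_of_nonneg_left (hcon τ hτ) hC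
      have h3 : 0 ≤ C * μ.real (P τ) := by positivity
      exact (ENNReal.ofReal_lt_ofReal_iff (by linarith)).2 (by linarith)
    have hev := eventually_lt_of_limsup_lt hlt
    refine hs_lim.frequently (hev.mono fun k hk => ?_).frequently
    rw [hslope k, integral_eq_lintegral_pos_part_sub_lintegral_neg_part (hqi k)]
    have h1 : (∫⁻ p, ENNReal.ofReal (q k p) ∂μ).toReal < r := by
      have hr0 : 0 < r := by
        by_contra! hneg
        rw [ENNReal.ofReal_of_nonpos hneg] at hk
        exact not_lt_zero hk
      exact (ENNReal.lt_ofReal_iff_toReal_lt (ne_top_of_lt hk)).1 hk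
    have h2 : 0 ≤ (∫⁻ p, ENNReal.ofReal (-q k p) ∂μ).toReal := ENNReal.toReal_nonneg
    linarith
  have hfin := image_le_of_liminf_slope_right_le_deriv_boundary hGcont
    (B := fun τ => G a + C * v₀ * (τ - a)) (B' := fun _ => C * v₀) (by simp)
    (by fun_prop)
    (fun τ _ => by
      have := (((hasDerivAt_id τ).sub_const a).const_mul (C * v₀)).const_add (G a)
      simpa using this.hasDerivWithinAt)
    key (right_mem_Icc.2 hab)
  have hle1 : c₀ * μ.real univ ≤ G b - G a := by
    simp only [hG]
    rw [← integral_sub (hintr b (right_mem_Icc.2 hab)) (hintr a (left_mem_Icc.2 hab))]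
    have := integral_mono (μ := μ) (integrable_const c₀)
      ((hintr b (right_mem_Icc.2 hab)).sub (hintr a (left_mem_Icc.2 hab))) (fun p => hrise p)
    rw [integral_const, smul_eq_mul] at this
    simp only [Pi.sub_apply] at this
    linarith
  linarith

end Rise

section Solutions

open Filter Topology

/-- Points of the integer lattice. -/
def IsLattice {n : ℕ} (e : En n) : Prop := ∀ i, ∃ k : ℤ, e i = (k : ℝ)

/-- The second difference of `u` in the direction `e`. -/
def sd {n : ℕ} (u : En n → ℝ → ℝ) (e x : En n) (t : ℝ) : ℝ := u (x + e) t + u (x - e) t - 2 * u x t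

/-- Ancient solutions of a parabolic Monge-Ampère equation with lattice-periodic right-hand side,
pinched spatial Hessian determinant and pinched time derivative. -/
structure Sol {n : ℕ} (l L m₁ m₂ : ℝ) (u : En n → ℝ → ℝ) : Prop where
  pinched : ∀ t ≤ 0, Pinched l L fun x => u x t
  hasDerivAt : ∀ x, ∀ t ≤ 0, HasDerivAt (u x) (timeDeriv u x t) t
  le_neg_timeDeriv : ∀ x, ∀ t ≤ 0, m₁ ≤ -timeDeriv u x t
  neg_timeDeriv_le : ∀ x, ∀ t ≤ 0, -timeDeriv u x t ≤ m₂
  periodic : ∀ e, IsLattice e → ∀ x, ∀ t ≤ 0,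
    -timeDeriv u (x + e) t * (hess (fun y => u y t) (x + e)).det
      = -timeDeriv u x t * (hess (fun y => u y t) x).det

variable {n : ℕ} {l L m₁ m₂ : ℝ} {u : En n → ℝ → ℝ}

lemma IsLattice.neg {e : En n} (he : IsLattice e) : IsLattice (-e) := fun i => by
  obtain ⟨k, hk⟩ := he i
  exact ⟨-k, by simp [hk]⟩

lemma Sol.le_sub (hu : Sol l L m₁ m₂ u) (x : En n) {s t : ℝ} (hst : s ≤ t) (ht : t ≤ 0) :
    m₁ * (t - s) ≤ u x s - u x t := by
  have h := (convex_Iic (0:ℝ)).mul_sub_le_image_sub_of_le_deriv (f := fun t => -u x t) (C := m₁)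
    (fun t ht => (hu.hasDerivAt x t ht).neg.continuousAt.continuousWithinAt)
    (fun t ht => (hu.hasDerivAt x t (mem_Iic.1 (interior_subset ht))).neg.differentiableAt.differentiableWithinAt)
    (fun t ht => by
      rw [(hu.hasDerivAt x t (mem_Iic.1 (interior_subset ht))).fun_neg.deriv]
      exact hu.le_neg_timeDeriv x t (mem_Iic.1 (interior_subset ht)))
    s (hst.trans ht) t ht hst
  linarith

lemma Sol.sub_le (hu : Sol l L m₁ m₂ u) (x : En n) {s t : ℝ} (hst : s ≤ t) (ht : t ≤ 0) :
    u x s - u x t ≤ m₂ * (t - s) := by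
  have h := (convex_Iic (0:ℝ)).image_sub_le_mul_sub_of_deriv_le (f := fun t => -u x t) (C := m₂)
    (fun t ht => (hu.hasDerivAt x t ht).neg.continuousAt.continuousWithinAt)
    (fun t ht => (hu.hasDerivAt x t (mem_Iic.1 (interior_subset ht))).neg.differentiableAt.differentiableWithinAt)
    (fun t ht => by
      rw [(hu.hasDerivAt x t (mem_Iic.1 (interior_subset ht))).fun_neg.deriv]
      exact hu.neg_timeDeriv_le x t (mem_Iic.1 (interior_subset ht)))
    s (hst.trans ht) t ht hst
  linarith

lemma Sol.abs_sub_le (hu : Sol l L m₁ m₂ u) (hm₁ : 0 < m₁) (x : En n) {s t : ℝ} (hs : s ≤ 0)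
    (ht : t ≤ 0) : |u x s - u x t| ≤ m₂ * |s - t| := by
  rcases le_total s t with h | h
  · have h1 := hu.le_sub x h ht
    have h2 := hu.sub_le x h ht
    rw [abs_of_nonpos (sub_nonpos.2 h), abs_of_nonneg (by nlinarith)]
    linarith
  · have h1 := hu.le_sub x h hs
    have h2 := hu.sub_le x h hs
    rw [abs_of_nonneg (sub_nonneg.2 h), abs_of_nonpos (by nlinarith)]
    linarith

lemma Sol.sd_nonneg (hu : Sol l L m₁ m₂ u) (e x : En n) {t : ℝ} (ht : t ≤ 0) :
    0 ≤ sd u e x t := by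
  have h1 := (hu.pinched t ht).convexOn.2 (mem_univ (x + e)) (mem_univ (x - e))
    (by norm_num : (0:ℝ) ≤ 1 / 2) (by norm_num : (0:ℝ) ≤ 1 / 2) (by norm_num)
  have h2 : (1 / 2 : ℝ) • (x + e) + (1 / 2 : ℝ) • (x - e) = x := by
    rw [← smul_add, add_add_sub_cancel, ← two_smul ℝ x, smul_smul]; norm_num
  rw [h2] at h1
  simp only [smul_eq_mul] at h1
  simp only [sd]
  linarith

/-- The auxiliary function `u - κ⁻¹ w`, with `w` the second difference of `u`. -/
def auxFun (u : En n → ℝ → ℝ) (e : En n) (κ t : ℝ) (y : En n) : ℝ :=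
  u y t + (-κ⁻¹) * (u (y + e) t + u (y + -e) t + (-2) * u y t)

lemma auxFun_eq (u : En n → ℝ → ℝ) (e : En n) (κ t : ℝ) (y : En n) :
    auxFun u e κ t y = u y t - κ⁻¹ * sd u e y t := by
  simp only [auxFun, sd, ← sub_eq_add_neg]; ring

lemma Sol.contDiff_auxFun (hu : Sol l L m₁ m₂ u) (e : En n) (κ : ℝ) {t : ℝ} (ht : t ≤ 0) :
    ContDiff ℝ 2 (auxFun u e κ t) := by
  have h := (hu.pinched t ht).contDiff
  have h1 : ∀ a : En n, ContDiff ℝ 2 fun y => u (y + a) t := fun a =>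
    h.comp (contDiff_id.add contDiff_const)
  exact h.add (contDiff_const.mul (((h1 e).add (h1 (-e))).add (contDiff_const.mul h)))

lemma Sol.hess_auxFun (hu : Sol l L m₁ m₂ u) (e : En n) (κ : ℝ) {t : ℝ} (ht : t ≤ 0) (x : En n) :
    hess (auxFun u e κ t) x = hess (fun y => u y t) x - κ⁻¹ • (hess (fun y => u y t) (x + e)
      + hess (fun y => u y t) (x + -e) - (2:ℝ) • hess (fun y => u y t) x) := by
  have h := (hu.pinched t ht).contDiff
  have h1 : ∀ a : En n, ContDiff ℝ 2 fun y => u (y + a) t := fun a =>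
    h.comp (contDiff_id.add contDiff_const)
  have e1 : hess (auxFun u e κ t) x = hess (fun y => u y t) x + (-κ⁻¹) •
      (hess (fun y => u (y + e) t) x + hess (fun y => u (y + -e) t) x
        + (-2 : ℝ) • hess (fun y => u y t) x) := by
    unfold auxFun
    rw [hess_add h (contDiff_const.mul (((h1 e).add (h1 (-e))).add (contDiff_const.mul h))),
      hess_const_mul (((h1 e).add (h1 (-e))).add (contDiff_const.mul h)),
      hess_add ((h1 e).add (h1 (-e))) (contDiff_const.mul h), hess_add (h1 e) (h1 (-e)),
      hess_const_mul h]
  rw [e1, hess_comp_add (fun y => u y t), hess_comp_add (fun y => u y t)]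
  ext i j
  simp
  ring

/-- The (negative) time derivative of `auxFun`. -/
def auxSpeed (u : En n → ℝ → ℝ) (e : En n) (κ t : ℝ) (x : En n) : ℝ :=
  -timeDeriv u x t - κ⁻¹ * (-timeDeriv u (x + e) t + -timeDeriv u (x + -e) t
    - 2 * -timeDeriv u x t)

lemma Sol.hasDerivAt_auxFun (hu : Sol l L m₁ m₂ u) (e : En n) (κ : ℝ) {t : ℝ} (ht : t ≤ 0)
    (x : En n) : HasDerivAt (fun t => auxFun u e κ t x) (-auxSpeed u e κ t x) t := by
  have h := (hu.hasDerivAt x t ht).fun_add (((((hu.hasDerivAt (x + e) t ht).fun_add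
    (hu.hasDerivAt (x + -e) t ht))).fun_add ((hu.hasDerivAt x t ht).const_mul (-2))).const_mul (-κ⁻¹))
  refine h.congr_deriv ?_
  simp only [auxSpeed]; ring

/-- Bounds at a point where an affine function touches `auxFun` from below. -/
lemma Sol.contact (hu : Sol l L m₁ m₂ u) (hl : 0 < l) (hm₁ : 0 < m₁) {e : En n} (he : IsLattice e)
    {κ : ℝ} (hκ : 0 < κ) {t : ℝ} (ht : t ≤ 0) {x p x₀ : En n} {c : ℝ}
    (hmin : IsLocalMin (fun y => auxFun u e κ t y + (-1) * (c + inner ℝ p (y - x₀))) x) :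
    gradient (auxFun u e κ t) x = p ∧ (0 ≤ auxSpeed u e κ t x →
      auxSpeed u e κ t x ≤ (n + 1) * m₂ ∧ |(hess (auxFun u e κ t) x).det| ≤ (n + 1) ^ n * L) := by
  have hcd := hu.contDiff_auxFun e κ ht
  have hP := hu.pinched t ht
  constructor
  · have := gradient_eq_zero_of_isLocalMin hmin
    rw [gradient_add_affine (hcd.differentiable (by norm_num))] at this
    exact sub_eq_zero.1 this
  · intro hs
    have hpsd := hess_posSemidef_of_isLocalMin
      (hcd.add (contDiff_const.mul (contDiff_affine p x₀ c))) hmin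
    rw [hess_add hcd (contDiff_const.mul (contDiff_affine _ _ _)),
      hess_const_mul (contDiff_affine _ _ _), hess_affine, smul_zero, add_zero,
      hu.hess_auxFun e κ ht] at hpsd
    have hpos : ∀ y, 0 < -timeDeriv u y t := fun y => hm₁.trans_le (hu.le_neg_timeDeriv y t ht)
    have hb := contact_bounds (hP.posDef hl x) (hP.posDef hl (x + e)).posSemidef
      (hP.posDef hl (x + -e)).posSemidef (hpos x) (hpos (x + e)) (hpos (x + -e))
      (hu.periodic e he x t ht) (hu.periodic (-e) he.neg x t ht) hκ hpsd hs
    rw [hu.hess_auxFun e κ ht]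
    refine ⟨hb.1.trans ?_, hb.2.trans ?_⟩
    · exact mul_le_mul_of_nonneg_left (hu.neg_timeDeriv_le x t ht) (by positivity)
    · exact mul_le_mul_of_nonneg_left (hP.det_le x) (by positivity)

end Solutions

section Contact

open Filter Topology
variable {n : ℕ} {l L m₁ m₂ : ℝ} {u : En n → ℝ → ℝ}

lemma sInf_image_le_add {S : Set (En n)} (hS : IsCompact S) (hne : S.Nonempty) {f g : En n → ℝ}
    (hf : Continuous f) (hg : Continuous g) {ε : ℝ} (h : ∀ x ∈ S, f x ≤ g x + ε) :
    sInf (f '' S) ≤ sInf (g '' S) + ε := by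
  obtain ⟨x, hx, hxe, -⟩ := hS.exists_sInf_image_eq_and_le hne hg.continuousOn
  rw [hxe]
  exact (csInf_le (hS.image hf).bddBelow (mem_image_of_mem f hx)).trans (h x hx)

/-- The measurability of the determinant constraint set used in the contact argument. -/
lemma continuous_hess_det {v : En n → ℝ} (hv : ContDiff ℝ 2 v) :
    Continuous fun x => (hess v x).det := by
  refine Continuous.matrix_det (continuous_matrix fun i j => ?_)
  have h1 : Continuous (fderiv ℝ (fderiv ℝ v)) :=
    (hv.fderiv_right (m := 1) (by norm_num)).continuous_fderiv (by norm_num)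
  simp only [hess_apply]
  exact (h1.clm_apply continuous_const).clm_apply continuous_const

lemma continuous_gradient {v : En n → ℝ} (hv : ContDiff ℝ 2 v) : Continuous (gradient v) :=
  continuous_iff_continuousAt.2 fun x =>
    (exists_hasFDerivAt_gradient hv x).choose_spec.1.continuousAt

/-- A right derivative bounds difference quotients. -/
lemma eventually_sub_le_of_hasDerivAt {f : ℝ → ℝ} {f' τ : ℝ} (h : HasDerivAt f f' τ) {η : ℝ}
    (hη : 0 < η) : ∀ᶠ σ in 𝓝[>] τ, f σ - f τ ≤ (f' + η) * (σ - τ) := by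
  have h1 : Tendsto (slope f τ) (𝓝[>] τ) (𝓝 f') :=
    (hasDerivAt_iff_tendsto_slope.1 h).mono_left (nhdsWithin_mono _ fun x hx => ne_of_gt hx)
  filter_upwards [h1.eventually (eventually_lt_nhds (by linarith : f' < f' + η)),
    self_mem_nhdsWithin] with σ hσ hσ'
  have h2 : 0 < σ - τ := sub_pos.2 hσ'
  rw [slope_def_field, div_lt_iff₀ h2] at hσ
  exact hσ.le

/-- Contact argument: if the second difference on a parabolic cylinder is controlled by its value
at the vertex, then at some time it is comparable to that value on a large set. -/
lemma Sol.exists_volume_ge (hu : Sol l L m₁ m₂ u) (hl : 0 < l) (hm₁ : 0 < m₁) (hm₂ : 0 < m₂)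
    {e : En n} (he : IsLattice e) {x₀ : En n} {t₀ : ℝ} (ht₀ : t₀ ≤ 0) {h : ℝ} (hh : 0 < h) {N : ℝ}
    (hN : 1 ≤ N) (hM : 0 < sd u e x₀ t₀)
    (hle : ∀ x, tang (fun y => u y t₀) x₀ x ≤ h → ∀ t ∈ Icc (t₀ - h / m₁) t₀,
      sd u e x t ≤ N * sd u e x₀ t₀)
    {q₀ : En n} {A : Matrix (Fin n) (Fin n) ℝ} (hA : A.det ≠ 0)
    (hbox : ∀ q, tang (fun y => u y t₀) x₀ q ≤ h → ∃ z ∈ box n 1, q = q₀ + lin A z) :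
    ∃ t ∈ Icc (t₀ - h / m₁) t₀,
      ENNReal.ofReal (m₁ / (16 * N * (n + 1) * m₂) * ((h / (16 * N * (n + 1))) ^ n / |A.det|)) ≤
        ENNReal.ofReal ((n + 1) ^ n * L) *
          volume {x | tang (fun y => u y t₀) x₀ x ≤ h ∧ sd u e x₀ t₀ / 4 ≤ sd u e x t} := by
  set M := sd u e x₀ t₀ with hMdef
  set v : En n → ℝ := fun y => u y t₀ with hv
  have hvP : Pinched l L v := hu.pinched t₀ ht₀
  set S : Set (En n) := {x | tang v x₀ x ≤ h} with hS
  have hScpt : IsCompact S := isCompact_section hl hvP x₀ h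
  have hx₀S : x₀ ∈ S := by
    show tang v x₀ x₀ ≤ h
    rw [tang_self]; exact hh.le
  have hSne : S.Nonempty := ⟨x₀, hx₀S⟩
  set κ : ℝ := 4 * N * M / h with hκ
  have hN0 : 0 < N := by linarith
  have hκ0 : 0 < κ := by positivity
  set g₀ := gradient v x₀ with hg₀
  set Φ : ℝ → En n → ℝ := fun t x => auxFun u e κ t x - v x₀ - inner ℝ g₀ (x - x₀) with hΦ
  have hΦeq : ∀ t x, Φ t x = (u x t - v x) + tang v x₀ x - κ⁻¹ * sd u e x t := by
    intro t x
    simp only [hΦ, auxFun_eq, tang, hg₀]; ring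
  have hΦc : ∀ t ≤ 0, Continuous (Φ t) := by
    intro t ht
    have := (hu.contDiff_auxFun e κ ht).continuous
    simp only [hΦ]; fun_prop
  set ρ : ℝ := h / (32 * N * (n + 1)) with hρ
  have hρ0 : 0 < ρ := by positivity
  set P : Set (En n) := lin A.transpose ⁻¹' box n ρ with hP
  have hAt : A.transpose.det ≠ 0 := by rwa [Matrix.det_transpose]
  have hPm : MeasurableSet P :=
    ((isClosed_box n ρ).preimage (lin A.transpose).continuous_of_finiteDimensional).measurableSet
  have hPvol : volume P = ENNReal.ofReal ((h / (16 * N * (n + 1))) ^ n / |A.det|) := by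
    rw [hP, volume_lin_preimage_box hAt hρ0.le, Matrix.det_transpose, hρ]
    congr 3; field_simp; ring
  set volP : ℝ := (h / (16 * N * (n + 1))) ^ n / |A.det| with hvolP
  have hvolP0 : 0 < volP := by
    have := abs_pos.2 hA
    positivity
  have hPin : ∀ p ∈ P, ∀ x ∈ S, |inner ℝ p (x - x₀)| ≤ h / (16 * N) := by
    intro p hp x hx
    refine (abs_inner_le_of_box (S := S) hbox hp hx hx₀S).trans ?_
    rw [hρ]
    have : 2 * (n:ℝ) * (h / (32 * N * (n + 1))) = h / (16 * N) * (n / (n + 1)) := by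
      field_simp; ring
    rw [this]
    refine mul_le_of_le_one_right (by positivity) ?_
    rw [div_le_one (by positivity)]; linarith
  set c₁ : ℝ := -(h / (8 * N)) with hc₁
  set f : En n → ℝ → En n → ℝ := fun p t x => Φ t x - inner ℝ p (x - x₀) with hf
  have hfc : ∀ p, ∀ t ≤ 0, Continuous (f p t) := by
    intro p t ht
    have := hΦc t ht
    simp only [hf]; fun_prop
  set m : En n → ℝ → ℝ := fun p t => sInf (f p t '' S) with hm
  have hmle : ∀ p, ∀ t ≤ 0, ∀ x ∈ S, m p t ≤ f p t x := fun p t ht x hx =>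
    csInf_le (hScpt.image (hfc p t ht)).bddBelow (mem_image_of_mem _ hx)
  have hmex : ∀ p, ∀ t ≤ 0, ∃ x ∈ S, m p t = f p t x := fun p t ht => by
    obtain ⟨x, hx, hxe, -⟩ := hScpt.exists_sInf_image_eq_and_le hSne (hfc p t ht).continuousOn
    exact ⟨x, hx, hxe⟩
  set K : ℝ := m₂ * (1 + 4 * κ⁻¹) with hK
  have hK0 : 0 ≤ K := by positivity
  have hΦlip : ∀ x, ∀ s ≤ 0, ∀ t ≤ 0, Φ s x ≤ Φ t x + K * |s - t| := by
    intro x s hs t ht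
    have h1 := abs_le.1 (hu.abs_sub_le hm₁ x hs ht)
    have h2 := abs_le.1 (hu.abs_sub_le hm₁ (x + e) hs ht)
    have h3 := abs_le.1 (hu.abs_sub_le hm₁ (x - e) hs ht)
    have h4 : κ⁻¹ * (sd u e x t - sd u e x s) ≤ κ⁻¹ * (4 * (m₂ * |s - t|)) := by
      refine mul_le_mul_of_nonneg_left ?_ (by positivity)
      simp only [sd]; linarith
    rw [hΦeq, hΦeq, hK]
    linarith
  have hmlip : ∀ p, ∀ s ≤ 0, ∀ t ≤ 0, |m p s - m p t| ≤ K * |s - t| := by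
    intro p s hs t ht
    have h1 : m p s ≤ m p t + K * |s - t| :=
      sInf_image_le_add hScpt hSne (hfc p s hs) (hfc p t ht) fun x _ => by
        simp only [hf]; linarith [hΦlip x s hs t ht]
    have h2 : m p t ≤ m p s + K * |s - t| :=
      sInf_image_le_add hScpt hSne (hfc p t ht) (hfc p s hs) fun x _ => by
        simp only [hf]; rw [abs_sub_comm]; linarith [hΦlip x t ht s hs]
    rw [abs_le]; constructor <;> linarith
  -- continuity in the slope
  have hmcont : ∀ t ≤ 0, Continuous fun p => m p t := by
    intro t ht
    obtain ⟨R, hR⟩ := hScpt.isBounded.exists_norm_le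
    have hR0 : 0 ≤ R := (norm_nonneg _).trans (hR x₀ hx₀S)
    have h1 : ∀ p p', m p t ≤ m p' t + 2 * R * dist p p' := fun p p' =>
      sInf_image_le_add hScpt hSne (hfc p t ht) (hfc p' t ht) fun x hx => by
        have h2 : inner ℝ p' (x - x₀) - inner ℝ p (x - x₀) ≤ 2 * R * dist p p' := by
          rw [← inner_sub_left, dist_comm, dist_eq_norm]
          refine (real_inner_le_norm _ _).trans ?_
          rw [mul_comm]
          refine mul_le_mul_of_nonneg_right ?_ (norm_nonneg _)
          refine (norm_sub_le _ _).trans ?_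
          linarith [hR x hx, hR x₀ hx₀S]
        simp only [hf]; linarith
    refine (LipschitzWith.of_dist_le_mul (K := (2 * R).toNNReal) fun p p' => ?_).continuous
    rw [Real.dist_eq, Real.coe_toNNReal _ (by positivity), abs_le]
    have h3 := h1 p p'
    have h4 := h1 p' p
    rw [dist_comm] at h4
    constructor <;> linarith
  -- bounds on the cylinder
  have hwk : ∀ x ∈ S, ∀ t ∈ Icc (t₀ - h / m₁) t₀, κ⁻¹ * sd u e x t ≤ h / 4 := by
    intro x hx t ht
    have h1 : κ⁻¹ * sd u e x t ≤ κ⁻¹ * (N * M) :=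
      mul_le_mul_of_nonneg_left (hle x hx t ht) (by positivity)
    have h2 : κ⁻¹ * (N * M) = h / 4 := by rw [hκ]; field_simp
    linarith
  have hut : ∀ x, ∀ t ≤ t₀, m₁ * (t₀ - t) ≤ u x t - v x := fun x t ht => hu.le_sub x ht ht₀
  -- the contact set
  set Γ : ℝ → Set (En n) := fun t =>
    {x | x ∈ S ∧ M / 4 ≤ sd u e x t ∧ |(hess (auxFun u e κ t) x).det| ≤ (n + 1) ^ n * L} with hΓ
  have hsdc : ∀ t ≤ 0, Continuous fun x => sd u e x t := by
    intro t ht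
    have := (hu.pinched t ht).continuous
    have h1 : ∀ a : En n, Continuous fun x => u (x + a) t := fun a =>
      this.comp (continuous_id.add continuous_const)
    have h2 : ∀ a : En n, Continuous fun x => u (x - a) t := fun a =>
      this.comp (continuous_id.sub continuous_const)
    exact ((h1 e).add (h2 e)).sub (continuous_const.mul this)
  have hΓcpt : ∀ t ≤ 0, IsCompact (Γ t) := by
    intro t ht
    have h1 := hsdc t ht
    have h2 := continuous_hess_det (hu.contDiff_auxFun e κ ht)
    refine hScpt.inter_right (t := {x | M / 4 ≤ sd u e x t ∧
      |(hess (auxFun u e κ t) x).det| ≤ (n + 1) ^ n * L}) ?_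
    exact (isClosed_le continuous_const h1).inter (isClosed_le h2.abs continuous_const)
  set PT : ℝ → Set (En n) := fun t =>
    (fun p => p + g₀) ⁻¹' (gradient (auxFun u e κ t) '' Γ t) with hPT
  have hPTm : ∀ t ≤ 0, MeasurableSet (PT t) := by
    intro t ht
    exact (((hΓcpt t ht).image (continuous_gradient (hu.contDiff_auxFun e κ ht))).isClosed.preimage
      (continuous_id.add continuous_const)).measurableSet
  -- upper right derivative of the minimum in reversed time
  have hspeed : ∀ p ∈ P, ∀ t, t₀ - h / m₁ < t → t ≤ t₀ → ∃ s : ℝ, s ≤ (n + 1) * m₂ ∧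
      (p ∉ PT t → s ≤ 0) ∧ ∀ η > 0, ∀ᶠ σ in 𝓝[>] (-t),
        min c₁ (m p (-σ)) - min c₁ (m p t) ≤ (s + η) * (σ - (-t)) := by
    intro p hp t hat htb
    have ht : t ≤ 0 := htb.trans ht₀
    have htI : t ∈ Icc (t₀ - h / m₁) t₀ := ⟨hat.le, htb⟩
    rcases le_or_gt c₁ (m p t) with hc | hc
    · refine ⟨0, by positivity, fun _ => le_rfl, fun η hη => ?_⟩
      filter_upwards [self_mem_nhdsWithin] with σ hσ
      have h1 : 0 < σ - -t := sub_pos.2 hσ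
      rw [min_eq_left hc]
      have h2 := min_le_left c₁ (m p (-σ))
      have : 0 ≤ (0 + η) * (σ - -t) := by positivity
      linarith
    · obtain ⟨x, hxS, hxe⟩ := hmex p t ht
      have hpx := abs_le.1 (hPin p hp x hxS)
      have hΦx : Φ t x < -(h / (16 * N)) := by
        have h1 : Φ t x - inner ℝ p (x - x₀) < c₁ := by rw [hxe] at hc; exact hc
        have h2 : h / (8 * N) = h / (16 * N) + h / (16 * N) := by field_simp; ring
        rw [hc₁] at h1
        linarith
      have hψ : 0 ≤ u x t - v x := by
        have := hut x t htb
        have h2 : 0 ≤ m₁ * (t₀ - t) := mul_nonneg hm₁.le (sub_nonneg.2 htb)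
        linarith
      have htn := tang_nonneg hvP x₀ x
      have hxw := hwk x hxS t htI
      have hpos16 : 0 < h / (16 * N) := by positivity
      rw [hΦeq] at hΦx
      have hxlt : tang v x₀ x < h := by linarith
      have hxM : M / 4 ≤ sd u e x t := by
        have h1 : h / (16 * N) < κ⁻¹ * sd u e x t := by linarith
        have h2 : h / (16 * N) = κ⁻¹ * (M / 4) := by rw [hκ]; field_simp; ring
        rw [h2] at h1
        exact (lt_of_mul_lt_mul_left h1 (by positivity)).le
      have hloc : IsLocalMin
          (fun y => auxFun u e κ t y + (-1) * (0 + inner ℝ (p + g₀) (y - x₀))) x := by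
        have hnhds : S ∈ 𝓝 x := by
          filter_upwards [(isOpen_lt (hvP.tang x₀).continuous continuous_const).mem_nhds hxlt]
            with y hy
          exact (le_of_lt hy : tang v x₀ y ≤ h)
        filter_upwards [hnhds] with y hy
        have h1 := hmle p t ht y hy
        rw [hxe] at h1
        simp only [hf, hΦ] at h1
        simp only [inner_add_left]
        linarith
      obtain ⟨hgrad, hbd⟩ := hu.contact hl hm₁ he hκ0 ht hloc
      have hder : HasDerivAt (fun σ => Φ (-σ) x) (auxSpeed u e κ t x) (-t) := by
        have h1 : HasDerivAt (fun t => auxFun u e κ t x) (-auxSpeed u e κ t x) (- -t) := by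
          rw [neg_neg]; exact hu.hasDerivAt_auxFun e κ ht x
        have h2 := (h1.comp (-t) (hasDerivAt_neg (-t))).sub_const (v x₀ + inner ℝ g₀ (x - x₀))
        refine (h2.congr_deriv (by ring)).congr_of_eventuallyEq (Eventually.of_forall fun σ => ?_)
        simp only [hΦ, Function.comp]; ring
      refine ⟨auxSpeed u e κ t x, ?_, ?_, fun η hη => ?_⟩
      · rcases le_or_gt 0 (auxSpeed u e κ t x) with h0 | h0
        · exact (hbd h0).1
        · exact h0.le.trans (by positivity)
      · intro hpT
        by_contra! h0
        exact hpT ⟨x, ⟨hxS, hxM, (hbd h0.le).2⟩, hgrad⟩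
      · have hneg : ∀ᶠ σ in 𝓝[>] (-t), -σ ≤ 0 := by
          filter_upwards [self_mem_nhdsWithin] with σ hσ
          have : -t < σ := hσ
          linarith
        filter_upwards [eventually_sub_le_of_hasDerivAt hder hη, hneg] with σ hσ hσ0
        have h1 := hmle p (-σ) hσ0 x hxS
        have h2 := min_le_right c₁ (m p (-σ))
        rw [min_eq_right hc.le, hxe]
        simp only [neg_neg] at hσ
        simp only [hf] at h1 ⊢
        linarith
  -- selection of a good time
  have hmT : t₀ - h / m₁ ≤ 0 := by
    have : 0 < h / m₁ := by positivity
    linarith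
  have hIcc : ∀ τ ∈ Icc (-t₀) (-t₀ + h / m₁), -τ ≤ 0 := fun τ hτ => by linarith [hτ.1]
  have : IsFiniteMeasure (volume.comap (Subtype.val : P → En n)) := by
    refine ⟨?_⟩
    rw [comap_subtype_coe_apply hPm, image_univ, Subtype.range_coe, hPvol]
    exact ENNReal.ofReal_lt_top
  have hreal : (volume.comap (Subtype.val : P → En n)).real univ = volP := by
    rw [Measure.real, comap_subtype_coe_apply hPm, image_univ, Subtype.range_coe, hPvol,
      ENNReal.toReal_ofReal hvolP0.le]
  have htop : ∀ p ∈ P, c₁ ≤ m p (t₀ - h / m₁) := by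
    intro p hp
    obtain ⟨x, hxS, hxe⟩ := hmex p _ hmT
    rw [hxe]
    have hpx := abs_le.1 (hPin p hp x hxS)
    have h0 : 0 < h / m₁ := by positivity
    have h1 := hut x (t₀ - h / m₁) (by linarith)
    have h2 : m₁ * (t₀ - (t₀ - h / m₁)) = h := by field_simp; ring
    have h3 := hwk x hxS (t₀ - h / m₁) ⟨le_rfl, by linarith⟩
    have h4 := tang_nonneg hvP x₀ x
    have h5 : h / (16 * N) ≤ h / 16 := by
      apply div_le_div_of_nonneg_left hh.le (by norm_num); linarith
    have h6 : 0 < h / (8 * N) := by positivity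
    simp only [hf]
    rw [hΦeq, hc₁]
    linarith
  have hbot : ∀ p, m p t₀ ≤ -(h / (4 * N)) := by
    intro p
    refine (hmle p t₀ ht₀ x₀ hx₀S).trans (le_of_eq ?_)
    simp only [hf]
    have h0 : u x₀ t₀ - v x₀ = 0 := sub_self _
    rw [hΦeq, tang_self, sub_self x₀, inner_zero_right, h0, ← hMdef, hκ]
    field_simp
    ring
  obtain ⟨τ, hτ, hlt⟩ := exists_lt_measure_of_rise (volume.comap (Subtype.val : P → En n))
    (fun p τ => min c₁ (m p (-τ))) (a := -t₀) (b := -t₀ + h / m₁) (K := K)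
    (B := |c₁| + K * (h / m₁)) (C := (n + 1) * m₂) (c₀ := h / (8 * N))
    (v₀ := m₁ / (16 * N * (n + 1) * m₂) * volP)
    (by have : 0 < h / m₁ := by positivity
        linarith)
    (by positivity)
    (fun τ hτ => (continuous_const.min
      ((hmcont (-τ) (hIcc τ hτ)).comp continuous_subtype_val)).measurable)
    (fun p σ hσ τ hτ => by
      refine (abs_min_sub_min_le_max _ _ _ _).trans ?_
      rw [sub_self, abs_zero]
      refine max_le (by positivity) ?_
      refine (hmlip p (-σ) (hIcc σ hσ) (-τ) (hIcc τ hτ)).trans (le_of_eq ?_)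
      rw [← abs_neg (σ - τ)]; congr 2; ring)
    (fun p τ hτ => by
      have hb := htop p p.2
      have h1 := hmlip p (-τ) (hIcc τ hτ) (t₀ - h / m₁) hmT
      have h2 : |-τ - (t₀ - h / m₁)| ≤ h / m₁ := by
        rw [abs_le]; constructor <;> linarith [hτ.1, hτ.2]
      have h3 : K * |-τ - (t₀ - h / m₁)| ≤ K * (h / m₁) := mul_le_mul_of_nonneg_left h2 hK0
      have h4 := (abs_le.1 h1).1
      have h5 : 0 ≤ K * (h / m₁) := by positivity
      have h6 := neg_abs_le c₁
      rw [abs_le]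
      refine ⟨le_min (by linarith) (by linarith), (min_le_left _ _).trans ?_⟩
      linarith [le_abs_self c₁])
    (fun τ => Subtype.val ⁻¹' PT (-τ))
    (fun τ hτ => measurable_subtype_coe (hPTm (-τ) (hIcc τ ⟨hτ.1, hτ.2.le⟩)))
    (fun p τ hτ η hη => by
      obtain ⟨s, hs, -, hev⟩ := hspeed p p.2 (-τ) (by linarith [hτ.2]) (by linarith [hτ.1])
      have := hev η hη
      rw [neg_neg] at this
      filter_upwards [this, self_mem_nhdsWithin] with σ hσ hσ'
      refine hσ.trans (mul_le_mul_of_nonneg_right (by linarith) (sub_nonneg.2 (le_of_lt hσ'))))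
    (fun τ hτ p hp η hη => by
      obtain ⟨s, -, hs, hev⟩ := hspeed p p.2 (-τ) (by linarith [hτ.2]) (by linarith [hτ.1])
      have := hev η hη
      rw [neg_neg] at this
      have hs0 := hs hp
      filter_upwards [this, self_mem_nhdsWithin] with σ hσ hσ'
      refine hσ.trans (mul_le_mul_of_nonneg_right (by linarith) (sub_nonneg.2 (le_of_lt hσ'))))
    (fun p => by
      have h1 := htop p p.2
      have h2 := hbot p
      have e1 : -(-t₀ + h / m₁) = t₀ - h / m₁ := by ring
      rw [e1, neg_neg, min_eq_left h1]
      have h3 := min_le_right c₁ (m p t₀)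
      have h4 : h / (4 * N) = h / (8 * N) + h / (8 * N) := by field_simp; ring
      rw [hc₁] at h3 ⊢
      linarith)
    (by
      rw [hreal]
      have e1 : (↑n + 1) * m₂ * (m₁ / (16 * N * (↑n + 1) * m₂) * volP) * (-t₀ + h / m₁ - -t₀)
          = h / (16 * N) * volP := by field_simp; ring
      rw [e1]
      refine mul_lt_mul_of_pos_right ?_ hvolP0
      have h4 : h / (8 * N) = h / (16 * N) + h / (16 * N) := by field_simp; ring
      have : 0 < h / (16 * N) := by positivity
      linarith)
  have htτ : -τ ∈ Icc (t₀ - h / m₁) t₀ := ⟨by linarith [hτ.2], by linarith [hτ.1]⟩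
  have htτ0 : -τ ≤ 0 := htτ.2.trans ht₀
  refine ⟨-τ, htτ, ?_⟩
  have h1 : ENNReal.ofReal (m₁ / (16 * N * (n + 1) * m₂) * volP) ≤ volume (PT (-τ)) := by
    have h2 : (volume.comap (Subtype.val : P → En n)) (Subtype.val ⁻¹' PT (-τ))
        ≤ volume (PT (-τ)) := by
      rw [comap_subtype_coe_apply hPm]
      exact measure_mono (image_preimage_subset _ _)
    refine le_trans ?_ h2
    rw [← ofReal_measureReal]
    exact ENNReal.ofReal_le_ofReal hlt.le
  refine h1.trans ?_
  simp only [hPT]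
  rw [measure_preimage_add_right]
  refine (volume_gradient_image_le (hu.contDiff_auxFun e κ htτ0)
    (hΓcpt _ htτ0).isClosed.measurableSet fun x hx => hx.2.2).trans ?_
  refine mul_le_mul_right (measure_mono fun x hx => ?_) _
  exact ⟨hx.1, hx.2.1⟩

end Contact

section Normalized

open Filter Topology
variable {n : ℕ} {l L m₁ m₂ : ℝ} {u : En n → ℝ → ℝ}

/-- Ancient solutions normalized at the origin, with positive pinching constants. -/
structure NormalizedSol {n : ℕ} (l L m₁ m₂ : ℝ) (u : En n → ℝ → ℝ) : Prop
    extends Sol l L m₁ m₂ u where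
  l_pos : 0 < l
  m₁_pos : 0 < m₁
  m₂_pos : 0 < m₂
  zero : u 0 0 = 0
  gradient_zero : gradient (fun y => u y 0) 0 = 0

lemma NormalizedSol.tang_zero (hu : NormalizedSol l L m₁ m₂ u) (x : En n) :
    tang (fun y => u y 0) 0 x = u x 0 := by
  simp [tang, hu.gradient_zero, hu.zero]

lemma NormalizedSol.initial_nonneg (hu : NormalizedSol l L m₁ m₂ u) (x : En n) : 0 ≤ u x 0 := by
  rw [← hu.tang_zero]; exact tang_nonneg (hu.pinched 0 le_rfl) 0 x

lemma NormalizedSol.le_apply (hu : NormalizedSol l L m₁ m₂ u) (x : En n) {t : ℝ} (ht : t ≤ 0) :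
    u x 0 + m₁ * (-t) ≤ u x t := by
  have := hu.le_sub x ht le_rfl
  linarith

lemma NormalizedSol.apply_le (hu : NormalizedSol l L m₁ m₂ u) (x : En n) {t : ℝ} (ht : t ≤ 0) :
    u x t ≤ u x 0 + m₂ * (-t) := by
  have := hu.sub_le x ht le_rfl
  linarith

lemma NormalizedSol.initial_le (hu : NormalizedSol l L m₁ m₂ u) (x : En n) {t : ℝ} (ht : t ≤ 0) :
    u x 0 ≤ u x t := by
  have := hu.le_apply x ht
  have := mul_nonneg hu.m₁_pos.le (neg_nonneg.2 ht)
  linarith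

lemma NormalizedSol.nonneg (hu : NormalizedSol l L m₁ m₂ u) (x : En n) {t : ℝ} (ht : t ≤ 0) :
    0 ≤ u x t := (hu.initial_nonneg x).trans (hu.initial_le x ht)

lemma NormalizedSol.neg_le (hu : NormalizedSol l L m₁ m₂ u) {x : En n} {t h : ℝ} (ht : t ≤ 0)
    (hx : u x t ≤ h) : -t ≤ h / m₁ := by
  rw [le_div_iff₀ hu.m₁_pos]
  have := hu.le_apply x ht
  have := hu.initial_nonneg x
  linarith

lemma NormalizedSol.isCompact_sublevel (hu : NormalizedSol l L m₁ m₂ u) (h : ℝ) :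
    IsCompact {x | u x 0 ≤ h} := by
  simpa only [hu.tang_zero] using isCompact_section hu.l_pos (hu.pinched 0 le_rfl) 0 h

lemma NormalizedSol.exists_isMin (hu : NormalizedSol l L m₁ m₂ u) {t : ℝ} (ht : t ≤ 0) :
    ∃ z, ∀ y, u z t ≤ u y t := by
  obtain ⟨z, hz, hmin⟩ := (hu.isCompact_sublevel (u 0 t)).exists_isMinOn
    ⟨0, hu.initial_le 0 ht⟩ (hu.pinched t ht).continuous.continuousOn
  refine ⟨z, fun y => ?_⟩
  rcases le_total (u y 0) (u 0 t) with h | h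
  · exact hmin h
  · have h0 : u z t ≤ u 0 t := hmin (show (0 : En n) ∈ {x | u x 0 ≤ u 0 t} from hu.initial_le 0 ht)
    exact h0.trans (h.trans (hu.initial_le y ht))

/-- Sections of comparable height are contained in comparable sublevel sets. -/
lemma exists_le_of_tang_le (n : ℕ) (L : ℝ) (hl : 0 < l) : ∃ C : ℝ, 1 ≤ C ∧
    ∀ v : En n → ℝ, Pinched l L v → (∃ z, ∀ y, v z ≤ v y) → (∀ y, 0 ≤ v y) →
      ∀ (h : ℝ) (x y : En n), v x ≤ h → tang v x y ≤ h → v y ≤ C * h := by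
  obtain ⟨C, hC, heng⟩ := exists_engulfing n L hl
  refine ⟨1 + C * C, by nlinarith, fun v hv ⟨z, hz⟩ hnn h x y hx hy => ?_⟩
  have hh : 0 ≤ h := (hnn x).trans hx
  have hgz : gradient v z = 0 := gradient_eq_zero_of_isLocalMin (Filter.Eventually.of_forall hz)
  have htz : ∀ w, tang v z w = v w - v z := fun w => by simp [tang, hgz]
  have h1 := heng v hv h z x z (by rw [htz]; linarith [hnn z]) (by rw [tang_self]; exact hh)
  have h2 := heng v hv (C * h) x z y h1 (hy.trans (by nlinarith))
  rw [htz] at h2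
  linarith [hz x]

lemma NormalizedSol.exists_apply_add_le (hu : NormalizedSol l L m₁ m₂ u) : ∃ C : ℝ, 1 ≤ C ∧
    ∀ (h : ℝ) (x y : En n), u x 0 ≤ h → u y 0 ≤ h → u (x + y) 0 ≤ C * h := by
  obtain ⟨k, hk⟩ := exists_growth n L hu.l_pos
  refine ⟨2 ^ k, one_le_pow₀ (by norm_num), fun h x y hx hy => ?_⟩
  have hg : ∀ z, u z 0 ≤ h → u ((2:ℝ) • z) 0 ≤ 2 ^ k * h := fun z hz => by
    have := hk _ (hu.pinched 0 le_rfl) 0 z 2 (by norm_num)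
    rw [zero_add, zero_add, hu.tang_zero, hu.tang_zero] at this
    exact this.trans (mul_le_mul_of_nonneg_left hz (by positivity))
  have h1 := (hu.pinched 0 le_rfl).convexOn.2 (mem_univ ((2:ℝ) • x)) (mem_univ ((2:ℝ) • y))
    (by norm_num : (0:ℝ) ≤ 1 / 2) (by norm_num : (0:ℝ) ≤ 1 / 2) (by norm_num)
  have h2 : (1 / 2 : ℝ) • (2:ℝ) • x + (1 / 2 : ℝ) • (2:ℝ) • y = x + y := by
    rw [smul_smul, smul_smul]; norm_num
  rw [h2] at h1
  simp only [smul_eq_mul] at h1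
  linarith [hg x hx, hg y hy]

lemma NormalizedSol.smul_le (hu : NormalizedSol l L m₁ m₂ u) {x : En n} {h s : ℝ}
    (hx : u x 0 ≤ h) (hs : 0 ≤ s) (hs' : s ≤ 1) : u (s • x) 0 ≤ s * h := by
  have h1 := (hu.pinched 0 le_rfl).convexOn.2 (mem_univ x) (mem_univ 0) hs (sub_nonneg.2 hs')
    (by ring)
  simp only [smul_zero, add_zero, hu.zero, smul_eq_mul, mul_zero] at h1
  exact h1.trans (mul_le_mul_of_nonneg_left hx hs)

lemma sum_sd (u : En n → ℝ → ℝ) (e x : En n) (t : ℝ) (K : ℕ) :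
    ∑ j ∈ Finset.range K, sd u e (x + (j:ℝ) • e) t
      = u (x + (K:ℝ) • e) t - u (x + ((K:ℝ) - 1) • e) t - (u x t - u (x - e) t) := by
  induction K with
  | zero => simp [← sub_eq_add_neg]
  | succ K ih =>
    rw [Finset.sum_range_succ, ih, sd]
    have h1 : x + (K:ℝ) • e + e = x + ((K + 1 : ℕ) : ℝ) • e := by push_cast; module
    have h2 : x + (K:ℝ) • e - e = x + ((K : ℝ) - 1) • e := by module
    have h3 : x + (((K + 1 : ℕ) : ℝ) - 1) • e = x + (K:ℝ) • e := by push_cast; module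
    rw [h1, h2, h3]
    ring

lemma sum_sd_le {t : ℝ} (hv : ConvexOn ℝ univ fun y => u y t) (hnn : ∀ y, 0 ≤ u y t) (e x : En n)
    {K : ℕ} (hK : 1 ≤ K) {B : ℝ} (h1 : u (x + (2 * K : ℝ) • e) t ≤ B)
    (h2 : u (x - (K:ℝ) • e) t ≤ B) :
    ∑ j ∈ Finset.range K, sd u e (x + (j:ℝ) • e) t ≤ 2 * B / K := by
  rw [sum_sd]
  have hK' : (1:ℝ) ≤ K := by exact_mod_cast hK
  have hK0 : (0:ℝ) < K := by linarith
  have a1 : (K:ℝ) * u (x + (K:ℝ) • e) t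
      ≤ (K:ℝ) * u (x + ((K:ℝ) - 1) • e) t + (u (x + (2 * K : ℝ) • e) t - u (x + (K:ℝ) • e) t) := by
    have h := hv.2 (mem_univ (x + ((K:ℝ) - 1) • e)) (mem_univ (x + (2 * K : ℝ) • e))
      (by positivity : (0:ℝ) ≤ K / (K + 1)) (by positivity : (0:ℝ) ≤ 1 / (K + 1)) (by field_simp)
    have hx : ((K:ℝ) / (K + 1)) • (x + ((K:ℝ) - 1) • e) + ((1:ℝ) / (K + 1)) • (x + (2 * K : ℝ) • e)
        = x + (K:ℝ) • e := by
      match_scalars <;> (field_simp; try ring)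
    rw [hx] at h
    simp only [smul_eq_mul] at h
    have h' : u (x + (K:ℝ) • e) t * (K + 1)
        ≤ K * u (x + ((K:ℝ) - 1) • e) t + u (x + (2 * K : ℝ) • e) t := by
      rw [← le_div_iff₀ (by positivity)]
      refine h.trans (le_of_eq ?_)
      field_simp
    linarith
  have a2 : (K:ℝ) * u (x - e) t ≤ (K:ℝ) * u x t + (u (x - (K:ℝ) • e) t - u x t) := by
    have h := hv.2 (mem_univ x) (mem_univ (x - (K:ℝ) • e))
      (div_nonneg (by linarith) hK0.le : (0:ℝ) ≤ (K - 1) / K) (by positivity : (0:ℝ) ≤ 1 / K)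
      (by field_simp; ring)
    have hx : (((K:ℝ) - 1) / K) • x + ((1:ℝ) / K) • (x - (K:ℝ) • e) = x - e := by
      match_scalars <;> (field_simp; try ring)
    rw [hx] at h
    simp only [smul_eq_mul] at h
    have h' : u (x - e) t * K ≤ (K - 1) * u x t + u (x - (K:ℝ) • e) t := by
      rw [← le_div_iff₀ (by positivity)]
      refine h.trans (le_of_eq ?_)
      field_simp
    linarith
  rw [le_div_iff₀ hK0]
  have := hnn x
  have := hnn (x + (K:ℝ) • e)
  linarith

/-- Averaging the telescoped second differences along chains in the direction `e`. -/
lemma mul_volume_le_of_chain {Γ Ω : Set (En n)} (hΓ : MeasurableSet Γ) (w : En n → ℝ) (e : En n)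
    (K : ℕ) {m B : ℝ} (hw : ∀ x, 0 ≤ w x) (hm : ∀ x ∈ Γ, m ≤ w x)
    (hsub : ∀ j < K, ∀ x ∈ Γ, x - (j:ℝ) • e ∈ Ω)
    (hsum : ∀ x ∈ Ω, ∑ j ∈ Finset.range K, w (x + (j:ℝ) • e) ≤ B) :
    ENNReal.ofReal (K * m) * volume Γ ≤ ENNReal.ofReal B * volume Ω := by
  have hmeas : ∀ j : ℕ, MeasurableSet ((fun x => x + (j:ℝ) • e) ⁻¹' Γ) := fun j =>
    (measurable_id.add_const _) hΓ
  have h1 : ∫⁻ x in Ω, ∑ j ∈ Finset.range K,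
      ((fun x => x + (j:ℝ) • e) ⁻¹' Γ).indicator (fun _ => ENNReal.ofReal m) x
      ≤ ENNReal.ofReal B * volume Ω := by
    rw [← setLIntegral_const]
    refine setLIntegral_mono measurable_const fun x hx => ?_
    refine le_trans ?_ (ENNReal.ofReal_le_ofReal (hsum x hx))
    rw [ENNReal.ofReal_sum_of_nonneg fun j _ => hw _]
    refine Finset.sum_le_sum fun j _ => ?_
    by_cases h : x ∈ (fun x => x + (j:ℝ) • e) ⁻¹' Γ
    · rw [indicator_of_mem h]; exact ENNReal.ofReal_le_ofReal (hm _ h)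
    · rw [indicator_of_notMem h]; exact zero_le
  refine le_trans (le_of_eq ?_) h1
  rw [lintegral_finsetSum _ fun j _ => measurable_const.indicator (hmeas j)]
  have h2 : ∀ j ∈ Finset.range K, ∫⁻ x in Ω,
      ((fun x => x + (j:ℝ) • e) ⁻¹' Γ).indicator (fun _ => ENNReal.ofReal m) x
      = ENNReal.ofReal m * volume Γ := fun j hj => by
    have hs : (fun x => x + (j:ℝ) • e) ⁻¹' Γ ⊆ Ω := fun x hx => by
      have := hsub j (Finset.mem_range.1 hj) _ hx
      rwa [add_sub_cancel_right] at this
    rw [lintegral_indicator_const (hmeas j), Measure.restrict_apply (hmeas j),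
      inter_eq_left.2 hs, measure_preimage_add_right]
  rw [Finset.sum_congr rfl h2, Finset.sum_const, Finset.card_range, nsmul_eq_mul, ← mul_assoc,
    ENNReal.ofReal_mul (Nat.cast_nonneg K), ENNReal.ofReal_natCast]

end Normalized

section Harnack

open Filter Topology
variable {n : ℕ} {l L m₁ m₂ : ℝ} {u : En n → ℝ → ℝ}

lemma mul_abs_le_of_sq_le {a b p q h : ℝ} (n : ℕ) (hl : 0 < l) (hp : 0 ≤ p) (hq : 1 ≤ q)
    (hh : 0 ≤ h) (ha : l * a ^ 2 ≤ (p * h) ^ n) (hb : l * b ^ 2 ≤ (p * (q * h)) ^ n) :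
    l * (|a| * |b|) ≤ (p * q) ^ n * h ^ n := by
  have hq0 : 0 ≤ q := by linarith
  refine abs_le_of_sq_le_sq' ?_ (by positivity) |>.2
  calc (l * (|a| * |b|)) ^ 2 = (l * a ^ 2) * (l * b ^ 2) := by
        rw [mul_pow, mul_pow, sq_abs, sq_abs]; ring
    _ ≤ (p * h) ^ n * (p * (q * h)) ^ n := mul_le_mul ha hb (by positivity) (by positivity)
    _ = ((p * h) ^ 2) ^ n * q ^ n := by rw [← mul_pow, ← mul_pow]; congr 1; ring
    _ ≤ ((p * h) ^ 2) ^ n * (q ^ 2) ^ n := by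
        refine mul_le_mul_of_nonneg_left (pow_le_pow_left₀ hq0 ?_ n) (by positivity)
        nlinarith
    _ = ((p * q) ^ n * h ^ n) ^ 2 := by ring

/-- Second differences which nearly attain their maximum on a parabolic section, in a direction
that fits `K` times into the section of height `h`, are controlled by `h / K ^ 2`. -/
lemma NormalizedSol.exists_sq_mul_sd_le (hu : NormalizedSol l L m₁ m₂ u) {N : ℝ} (hN : 1 ≤ N) :
    ∃ C : ℝ, 0 < C ∧ ∀ h : ℝ, 0 < h → ∀ e : En n, IsLattice e → ∀ K : ℕ, 1 ≤ K →
      u ((K:ℝ) • e) 0 ≤ h → u (-((K:ℝ) • e)) 0 ≤ h → ∀ (x₀ : En n) (t₀ : ℝ), t₀ ≤ 0 → u x₀ t₀ ≤ h →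
      (∀ x, tang (fun y => u y t₀) x₀ x ≤ h → ∀ t ∈ Icc (t₀ - h / m₁) t₀,
        sd u e x t ≤ N * sd u e x₀ t₀) → (K:ℝ) ^ 2 * sd u e x₀ t₀ ≤ C * h := by
  have hl := hu.l_pos
  have hm₁ := hu.m₁_pos
  have hm₂ := hu.m₂_pos
  have hN0 : 0 < N := by linarith
  have hL : 0 < L := hl.trans_le (((hu.pinched 0 le_rfl).le_det 0).trans
    ((hu.pinched 0 le_rfl).det_le 0))
  obtain ⟨C₁, hC₁, hsec⟩ := exists_le_of_tang_le n L hl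
  obtain ⟨D, hD, hadd⟩ := hu.exists_apply_add_le
  set C₂ : ℝ := D * C₁ with hC₂
  have hC₂1 : 1 ≤ C₂ := by nlinarith
  set C₃ : ℝ := D * (D * C₂) + m₂ * (2 / m₁) with hC₃
  have hC₃0 : 0 < C₃ := by positivity
  set P : ℝ := (n + 1) ^ n * L with hP
  have hP0 : 0 < P := by positivity
  set c₀ : ℝ := m₁ / (16 * N * (n + 1) * m₂) / (16 * N * (n + 1)) ^ n with hc₀
  have hc₀0 : 0 < c₀ := by positivity
  set p : ℝ := 32 * (n + 1) ^ 2 with hp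
  refine ⟨8 * P * C₃ * 2 ^ n * (p * C₂) ^ n / (l * c₀), by positivity, ?_⟩
  intro h hh e he K hK hKe hKe' x₀ t₀ ht₀ hx₀ hle
  have hK' : (1:ℝ) ≤ K := by exact_mod_cast hK
  have hK0 : (0:ℝ) < K := by linarith
  rcases (hu.sd_nonneg e x₀ ht₀).eq_or_lt with hM | hM
  · rw [← hM, mul_zero]; positivity
  have hv := hu.pinched t₀ ht₀
  have hscpt := isCompact_section hl hv x₀ h
  obtain ⟨q₀, A, hA, hAdet, hbox⟩ := exists_section_box hl (hv.tang x₀) (tang_nonneg hv x₀) hh hscpt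
    (y := x₀) (by rw [tang_self]; exact hh)
  obtain ⟨t, ht, hvol⟩ := hu.exists_volume_ge hl hm₁ hm₂ he ht₀ hh hN hM hle hA hbox
  have ht0 : t ≤ 0 := ht.2.trans ht₀
  have ht' : -t ≤ 2 / m₁ * h := by
    have h1 := hu.neg_le ht₀ hx₀
    have h2 : 2 / m₁ * h = h / m₁ + h / m₁ := by ring
    linarith [ht.1]
  have hv0 := hu.pinched 0 le_rfl
  obtain ⟨r₀, R, hR, hRdet, hRbox⟩ := exists_section_box hl hv0 hu.initial_nonneg
    (h := C₂ * h) (by positivity) (hu.isCompact_sublevel _) (y := 0) (by rw [hu.zero]; positivity)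
  set Γ := {x | tang (fun y => u y t₀) x₀ x ≤ h ∧ sd u e x₀ t₀ / 4 ≤ sd u e x t} with hΓ
  have hcont : Continuous fun x => sd u e x t := by
    have hc := (hu.pinched t ht0).continuous
    exact ((hc.comp (continuous_add_const e)).add (hc.comp (continuous_id.sub continuous_const))).sub
      (continuous_const.mul hc)
  have hΓm : MeasurableSet Γ :=
    ((isClosed_sublevel (hv.tang x₀) h).inter (isClosed_le continuous_const hcont)).measurableSet
  have hstep : ∀ j < K, u (-((j:ℝ) • e)) 0 ≤ C₁ * h := fun j hj => by
    have hj' : (j:ℝ) ≤ K := by exact_mod_cast hj.le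
    have := hu.smul_le hKe' (s := j / K) (by positivity) ((div_le_one hK0).2 hj')
    have e1 : ((j:ℝ) / K) • -((K:ℝ) • e) = -((j:ℝ) • e) := by
      rw [smul_neg, smul_smul, div_mul_cancel₀ _ hK0.ne']
    rw [e1] at this
    refine this.trans ?_
    have h1 : (j:ℝ) / K * h ≤ 1 * h := mul_le_mul_of_nonneg_right ((div_le_one hK0).2 hj') hh.le
    nlinarith
  have hchain := mul_volume_le_of_chain (Ω := {x | u x 0 ≤ C₂ * h}) hΓm (fun x => sd u e x t) e K
    (m := sd u e x₀ t₀ / 4) (B := 2 * (C₃ * h) / K) (fun x => hu.sd_nonneg e x ht0)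
    (fun x hx => hx.2)
    (fun j hj x hx => by
      have h1 : u x 0 ≤ C₁ * h := (hu.initial_le x ht₀).trans
        (hsec _ hv (hu.exists_isMin ht₀) (fun y => hu.nonneg y ht₀) h x₀ x hx₀ hx.1)
      have h2 := hadd _ x (-((j:ℝ) • e)) h1 (hstep j hj)
      rw [← sub_eq_add_neg, ← mul_assoc] at h2
      exact h2)
    (fun x hx => by
      have hx' : u x 0 ≤ C₂ * h := hx
      have hC₂h : h ≤ C₂ * h := by nlinarith
      have hDh : C₂ * h ≤ D * (C₂ * h) := by nlinarith
      have h1 := hadd _ x ((K:ℝ) • e) hx' (hKe.trans hC₂h)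
      have h2 := hadd _ _ ((K:ℝ) • e) h1 (hKe.trans (hC₂h.trans hDh))
      have h3 := hadd _ x (-((K:ℝ) • e)) hx' (hKe'.trans hC₂h)
      have hDh2 : D * (C₂ * h) ≤ D * (D * (C₂ * h)) := by nlinarith
      have e1 : x + (K:ℝ) • e + (K:ℝ) • e = x + (2 * K : ℝ) • e := by module
      rw [e1] at h2
      rw [← sub_eq_add_neg] at h3
      have hmt : m₂ * (-t) ≤ m₂ * (2 / m₁ * h) := mul_le_mul_of_nonneg_left ht' hm₂.le
      have eC : C₃ * h = D * (D * (C₂ * h)) + m₂ * (2 / m₁ * h) := by rw [hC₃]; ring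
      refine sum_sd_le (hu.pinched t ht0).convexOn (fun y => hu.nonneg y ht0) e x hK ?_ ?_
      · have := hu.apply_le (x + (2 * K : ℝ) • e) ht0
        linarith
      · have := hu.apply_le (x - (K : ℝ) • e) ht0
        linarith)
  have hΩ := volume_le_of_box (S := {x | u x 0 ≤ C₂ * h}) hRbox
  have hfin : ENNReal.ofReal (K * (sd u e x₀ t₀ / 4)) * ENNReal.ofReal
      (m₁ / (16 * N * (n + 1) * m₂) * ((h / (16 * N * (n + 1))) ^ n / |A.det|))
      ≤ ENNReal.ofReal P * (ENNReal.ofReal (2 * (C₃ * h) / K) * ENNReal.ofReal (|R.det| * 2 ^ n)) :=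
    calc _ ≤ ENNReal.ofReal (K * (sd u e x₀ t₀ / 4)) * (ENNReal.ofReal P * volume Γ) := by gcongr
      _ = ENNReal.ofReal P * (ENNReal.ofReal (K * (sd u e x₀ t₀ / 4)) * volume Γ) := by ring
      _ ≤ ENNReal.ofReal P * (ENNReal.ofReal (2 * (C₃ * h) / K) * volume {x | u x 0 ≤ C₂ * h}) := by
        gcongr
      _ ≤ _ := by gcongr
  have hA0 : 0 < |A.det| := abs_pos.2 hA
  rw [← ENNReal.ofReal_mul (by positivity), ← ENNReal.ofReal_mul (by positivity),
    ← ENNReal.ofReal_mul (by positivity), ENNReal.ofReal_le_ofReal_iff (by positivity)] at hfin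
  have hdet := mul_abs_le_of_sq_le n hl (by positivity : 0 ≤ p) hC₂1 hh.le hAdet hRdet
  have e1 : m₁ / (16 * N * (n + 1) * m₂) * ((h / (16 * N * (n + 1))) ^ n / |A.det|)
      = c₀ * h ^ n / |A.det| := by rw [hc₀, div_pow]; ring
  rw [e1] at hfin
  have h1 : (K:ℝ) ^ 2 * sd u e x₀ t₀ * (c₀ * h ^ n) ≤ 8 * P * C₃ * h * 2 ^ n * (|A.det| * |R.det|) := by
    have := mul_le_mul_of_nonneg_right hfin (by positivity : 0 ≤ 4 * K * |A.det|)
    refine le_trans (le_of_eq ?_) (this.trans (le_of_eq ?_))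
    · field_simp
    · field_simp; ring
  have h2 : (K:ℝ) ^ 2 * sd u e x₀ t₀ * (c₀ * h ^ n) * l
      ≤ 8 * P * C₃ * h * 2 ^ n * ((p * C₂) ^ n * h ^ n) := by
    calc _ ≤ 8 * P * C₃ * h * 2 ^ n * (|A.det| * |R.det|) * l :=
          mul_le_mul_of_nonneg_right h1 hl.le
      _ = 8 * P * C₃ * h * 2 ^ n * (l * (|A.det| * |R.det|)) := by ring
      _ ≤ _ := mul_le_mul_of_nonneg_left hdet (by positivity)
  rw [div_mul_eq_mul_div, le_div_iff₀ (by positivity)]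
  refine le_of_mul_le_mul_right ?_ (by positivity : 0 < h ^ n)
  refine le_trans (le_of_eq ?_) (h2.trans (le_of_eq ?_)) <;> ring

end Harnack

section Heights

open Filter Topology
variable {n : ℕ} {l L m₁ m₂ : ℝ} {u : En n → ℝ → ℝ}

/-- A function of cubic growth satisfies a doubling inequality at arbitrarily large scales. -/
lemma exists_doubling {q : ℝ → ℝ} {a C : ℝ} (ha : 1 < a) (hq : ∀ h, 0 ≤ q h)
    (hqC : ∀ h, 1 ≤ h → q h ≤ C * h ^ 3) (H : ℝ) : ∃ h, H ≤ h ∧ 1 ≤ h ∧ q (a * h) ≤ a ^ 4 * q h := by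
  by_contra! hcon
  set h₁ := max H 1 with hh₁
  have h11 : 1 ≤ h₁ := le_max_right _ _
  have ha0 : 0 < a := by linarith
  set h₀ := a * h₁ with hh₀
  have h01 : h₁ ≤ h₀ := by nlinarith
  have hpos : 0 < q h₀ := by
    have := hcon h₁ (le_max_left _ _) h11
    have := mul_nonneg (pow_nonneg ha0.le 4) (hq h₁)
    linarith
  have hge : ∀ j : ℕ, h₀ ≤ a ^ j * h₀ := fun j => by
    have : 1 ≤ a ^ j := one_le_pow₀ ha.le
    nlinarith
  have hiter : ∀ j : ℕ, a ^ (4 * j) * q h₀ ≤ q (a ^ j * h₀) := by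
    intro j
    induction j with
    | zero => simp
    | succ j ih =>
      have h1 := hcon (a ^ j * h₀) ((le_max_left _ _).trans (h01.trans (hge j)))
        (h11.trans (h01.trans (hge j)))
      have h2 : a * (a ^ j * h₀) = a ^ (j + 1) * h₀ := by ring
      rw [h2] at h1
      have h3 : a ^ (4 * (j + 1)) * q h₀ = a ^ 4 * (a ^ (4 * j) * q h₀) := by ring
      rw [h3]
      exact (mul_le_mul_of_nonneg_left ih (by positivity)).trans h1.le
  obtain ⟨j, hj⟩ := pow_unbounded_of_one_lt (C * h₀ ^ 3 / q h₀) ha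
  have h1 := (hiter j).trans (hqC _ (h11.trans (h01.trans (hge j))))
  rw [div_lt_iff₀ hpos] at hj
  have h2 : 0 < a ^ (3 * j) := by positivity
  have h3 := mul_lt_mul_of_pos_left hj h2
  have h4 : a ^ (3 * j) * (a ^ j * q h₀) = a ^ (4 * j) * q h₀ := by ring
  have h5 : C * (a ^ j * h₀) ^ 3 = a ^ (3 * j) * (C * h₀ ^ 3) := by ring
  linarith

lemma IsLattice.one_le_norm {e : En n} (he : IsLattice e) (h0 : e ≠ 0) : 1 ≤ ‖e‖ := by
  obtain ⟨i, hi⟩ : ∃ i, e i ≠ 0 := by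
    by_contra! h
    exact h0 (by ext i; simpa using h i)
  obtain ⟨k, hk⟩ := he i
  have h1 := PiLp.norm_apply_le e i
  rw [hk] at h1 hi
  have h2 : (1:ℝ) ≤ |(k:ℝ)| := by
    have hk0 : k ≠ 0 := by rintro rfl; simp at hi
    exact_mod_cast Int.one_le_abs hk0
  exact h2.trans h1

/-- The scaled second differences `K ^ 2 * sd u e x t` with `x` in the section of height `h`,
in lattice directions `e` that fit `K` times into that section. -/
def scaledDiffs (u : En n → ℝ → ℝ) (h : ℝ) : Set ℝ :=
  {q | ∃ e : En n, IsLattice e ∧ e ≠ 0 ∧ ∃ K : ℕ, 1 ≤ K ∧ u ((K:ℝ) • e) 0 ≤ h ∧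
    u (-((K:ℝ) • e)) 0 ≤ h ∧ ∃ (x : En n) (t : ℝ), t ≤ 0 ∧ u x t ≤ h ∧ q = (K:ℝ) ^ 2 * sd u e x t}

lemma NormalizedSol.exists_scaledDiffs_le (hu : NormalizedSol l L m₁ m₂ u) :
    ∃ C : ℝ, 0 ≤ C ∧ ∀ h, 0 ≤ h → ∀ q ∈ scaledDiffs u h, q ≤ C * h ^ 3 := by
  have hm₁ := hu.m₁_pos
  have hm₂ := hu.m₂_pos
  obtain ⟨D, hD, hadd⟩ := hu.exists_apply_add_le
  obtain ⟨c, hc, hgrow⟩ := exists_linear_growth hu.l_pos (hu.pinched 0 le_rfl) 0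
  refine ⟨c⁻¹ ^ 2 * (2 * (D + m₂ / m₁)), by positivity, ?_⟩
  rintro h hh q ⟨e, he, he0, K, hK, hKe, hKe', x, t, ht, hx, rfl⟩
  have hK' : (1:ℝ) ≤ K := by exact_mod_cast hK
  have hK0 : (0:ℝ) < K := by linarith
  have hn : (K:ℝ) ≤ ‖(K:ℝ) • e‖ := by
    rw [norm_smul, Real.norm_natCast]
    nlinarith [he.one_le_norm he0]
  have h1 : (K:ℝ) ≤ c⁻¹ * h := by
    have := hgrow ((K:ℝ) • e) (by rw [sub_zero]; linarith)
    rw [sub_zero, hu.tang_zero] at this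
    rw [inv_mul_eq_div, le_div_iff₀ hc]
    nlinarith
  have hfit : ∀ y : En n, u ((K:ℝ) • y) 0 ≤ h → u y 0 ≤ h := fun y hy => by
    have := hu.smul_le hy (s := (K:ℝ)⁻¹) (by positivity) (inv_le_one_of_one_le₀ hK')
    rw [smul_smul, inv_mul_cancel₀ hK0.ne', one_smul] at this
    refine this.trans ?_
    have := inv_le_one_of_one_le₀ hK'
    nlinarith
  have hx0 := (hu.initial_le x ht).trans hx
  have hmt : m₂ * (-t) ≤ m₂ / m₁ * h := by
    have := mul_le_mul_of_nonneg_left (hu.neg_le ht hx) hm₂.le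
    exact this.trans (le_of_eq (by ring))
  have hb : ∀ y : En n, u y 0 ≤ h → u (x + y) t ≤ (D + m₂ / m₁) * h := fun y hy => by
    have := hu.apply_le (x + y) ht
    have := hadd h x y hx0 hy
    linarith
  have h2 : sd u e x t ≤ 2 * (D + m₂ / m₁) * h := by
    have a1 := hb e (hfit e hKe)
    have a2 := hb (-e) (hfit (-e) (by rwa [smul_neg]))
    rw [← sub_eq_add_neg] at a2
    have := hu.nonneg x ht
    rw [sd]
    linarith
  calc (K:ℝ) ^ 2 * sd u e x t ≤ (c⁻¹ * h) ^ 2 * (2 * (D + m₂ / m₁) * h) :=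
        mul_le_mul (pow_le_pow_left₀ hK0.le h1 2) h2 (hu.sd_nonneg e x ht) (by positivity)
    _ = _ := by ring

/-- At arbitrarily large heights the scaled second differences grow at most linearly. -/
lemma NormalizedSol.exists_height (hu : NormalizedSol l L m₁ m₂ u) :
    ∃ C : ℝ, 0 < C ∧ ∀ H : ℝ, ∃ h, H ≤ h ∧ 1 ≤ h ∧ ∀ q ∈ scaledDiffs u h, q ≤ C * h := by
  have hm₁ := hu.m₁_pos
  have hm₂ := hu.m₂_pos
  obtain ⟨C₁, hC₁, hsec⟩ := exists_le_of_tang_le n L hu.l_pos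
  set a : ℝ := C₁ + m₂ / m₁ with ha
  have ha1 : 1 < a := by have : 0 < m₂ / m₁ := by positivity
                         linarith
  have ha4 : 1 ≤ a ^ 4 := one_le_pow₀ ha1.le
  obtain ⟨C, hC, hkey⟩ := hu.exists_sq_mul_sd_le (N := 2 * a ^ 4) (by linarith)
  obtain ⟨C', hC', hcubic⟩ := hu.exists_scaledDiffs_le
  refine ⟨2 * C, by positivity, fun H => ?_⟩
  have hnonneg : ∀ h, ∀ q ∈ scaledDiffs u h, 0 ≤ q := by
    rintro h q ⟨e, he, he0, K, hK, hKe, hKe', x, t, ht, hx, rfl⟩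
    have := hu.sd_nonneg e x ht
    positivity
  obtain ⟨h, hH, h1, hdoub⟩ := exists_doubling (q := fun h => sSup (scaledDiffs u h)) ha1
    (fun h => Real.sSup_nonneg (hnonneg h))
    (fun h hh => Real.sSup_le (hcubic h (by linarith)) (by positivity)) H
  have hh0 : 0 < h := by linarith
  have hah : h ≤ a * h := by nlinarith
  refine ⟨h, hH, h1, fun q hq => ?_⟩
  have hbdd : ∀ h, 0 ≤ h → BddAbove (scaledDiffs u h) := fun h hh => ⟨_, hcubic h hh⟩
  have hqs : q ≤ sSup (scaledDiffs u h) := le_csSup (hbdd h hh0.le) hq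
  rcases (Real.sSup_nonneg (hnonneg h)).eq_or_lt with hs | hs
  · rw [← hs] at hqs
    exact hqs.trans (by positivity)
  obtain ⟨q', hq', hlt⟩ := exists_lt_of_lt_csSup ⟨q, hq⟩ (half_lt_self hs)
  obtain ⟨e, he, he0, K, hK, hKe, hKe', x, t, ht, hx, rfl⟩ := hq'
  have hK0 : (0:ℝ) < K := by exact_mod_cast hK
  have := hkey h hh0 e he K hK hKe hKe' x t ht hx (fun y hy s hs => by
    have hs0 : s ≤ 0 := hs.2.trans ht
    have hy1 := hsec _ (hu.pinched t ht) (hu.exists_isMin ht) (fun y => hu.nonneg y ht) h x y hx hy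
    have hy2 := hu.sub_le y hs.2 ht
    have hy3 : m₂ * (t - s) ≤ m₂ / m₁ * h := by
      have : t - s ≤ h / m₁ := by linarith [hs.1]
      exact (mul_le_mul_of_nonneg_left this hm₂.le).trans (le_of_eq (by ring))
    have hy4 : u y s ≤ a * h := by rw [ha]; linarith
    have hy5 : (K:ℝ) ^ 2 * sd u e y s ≤ sSup (scaledDiffs u (a * h)) :=
      le_csSup (hbdd _ (by linarith)) ⟨e, he, he0, K, hK, hKe.trans hah, hKe'.trans hah, y, s, hs0,
        hy4, rfl⟩
    have hy6 := hy5.trans hdoub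
    have hy7 : (K:ℝ) ^ 2 * sd u e y s ≤ (K:ℝ) ^ 2 * (2 * a ^ 4 * sd u e x t) := by
      have := mul_lt_mul_of_pos_left hlt (by positivity : 0 < a ^ 4)
      linarith
    exact le_of_mul_le_mul_left hy7 (by positivity))
  linarith

end Heights

section Lattices

open Filter Topology
open scoped Pointwise
variable {n : ℕ}

lemma exists_isLattice_mem {s : Set (En n)} (hsymm : ∀ x ∈ s, -x ∈ s) (hconv : Convex ℝ s)
    (hvol : 2 ^ n < volume s) : ∃ g, IsLattice g ∧ g ≠ 0 ∧ g ∈ s := by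
  set b := (EuclideanSpace.basisFun (Fin n) ℝ).toBasis with hb
  have hF : volume (ZSpan.fundamentalDomain b) = 1 := by
    rw [measure_congr (ZSpan.fundamentalDomain_ae_parallelepiped b volume), hb,
      OrthonormalBasis.coe_toBasis]
    exact (EuclideanSpace.basisFun (Fin n) ℝ).volume_parallelepiped
  have : Countable (Submodule.span ℤ (range b)).toAddSubgroup :=
    inferInstanceAs (Countable (Submodule.span ℤ (range b)))
  obtain ⟨⟨g, hg⟩, hg0, hgs⟩ := exists_ne_zero_mem_lattice_of_measure_mul_two_pow_lt_measure
    (ZSpan.isAddFundamentalDomain' b volume) hsymm hconv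
    (by rwa [hF, one_mul, finrank_euclideanSpace_fin])
  refine ⟨g, fun i => ?_, fun h => hg0 (Subtype.ext h), hgs⟩
  have h1 : g ∈ Submodule.span ℤ (range b) := hg
  obtain ⟨k, hk⟩ := (b.mem_span_iff_repr_mem ℤ g).1 h1 i
  refine ⟨k, ?_⟩
  have h2 : b.repr g i = g i := by
    rw [hb, OrthonormalBasis.coe_toBasis_repr_apply, EuclideanSpace.basisFun_repr]
  rw [← h2, ← hk]; simp

lemma seminorm_le_eq_smul (p : Seminorm ℝ (En n)) {s : ℝ} (hs : 0 < s) :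
    {x | p x ≤ s} = s • {x | p x ≤ 1} := by
  ext x
  rw [mem_smul_set_iff_inv_smul_mem₀ hs.ne']
  simp only [mem_ofPred_eq, map_smul_eq_mul, norm_inv, Real.norm_eq_abs, abs_of_pos hs]
  rw [inv_mul_le_iff₀ hs, mul_one]

lemma volume_seminorm_le (p : Seminorm ℝ (En n)) {s : ℝ} (hs : 0 < s) :
    volume {x | p x ≤ s} = ENNReal.ofReal (s ^ n) * volume {x | p x ≤ 1} := by
  rw [seminorm_le_eq_smul p hs, Measure.addHaar_smul, finrank_euclideanSpace_fin, abs_of_pos (by positivity)]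

/-- A unit ball of volume bounded below without small lattice points has controlled lattice points
outside any given hyperplane. -/
lemma exists_lattice_apply_ne_zero (n : ℕ) {c s₁ : ℝ} (hc : 0 < c) (hs₁ : 0 < s₁) :
    ∃ s₂ : ℝ, 0 < s₂ ∧ ∀ p : Seminorm ℝ (En n), IsCompact {x | p x ≤ 1} →
      ENNReal.ofReal c ≤ volume {x | p x ≤ 1} → (∀ g, IsLattice g → g ≠ 0 → s₁ < p g) →
      ∀ f : En n →ₗ[ℝ] ℝ, f ≠ 0 → ∃ g, IsLattice g ∧ p g ≤ s₂ ∧ f g ≠ 0 := by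
  set J : ℕ := ⌊2 ^ n / ((s₁ / 3) ^ n * c)⌋₊ + 1 with hJ
  have hJ2 : (2:ℝ) ^ n < J * ((s₁ / 3) ^ n * c) := by
    rw [← div_lt_iff₀ (by positivity), hJ]
    push_cast
    exact Nat.lt_floor_add_one _
  refine ⟨s₁ / 3 + J * s₁, by positivity, fun p hcpt hvol hmin f hf => ?_⟩
  by_contra! hker
  obtain ⟨v, hv, hmax⟩ := hcpt.exists_isMaxOn ⟨0, by simp⟩ f.continuous_of_finiteDimensional.continuousOn
  set m := f v with hm
  have hle : ∀ r : ℝ, 0 < r → ∀ x, p x ≤ r → f x ≤ m * r := fun r hr x hx => by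
    have h1 : f (r⁻¹ • x) ≤ m := hmax (show p (r⁻¹ • x) ≤ 1 by
      rw [map_smul_eq_mul, norm_inv, Real.norm_eq_abs, abs_of_pos hr, inv_mul_le_iff₀ hr, mul_one]
      exact hx)
    rw [map_smul, smul_eq_mul, inv_mul_le_iff₀ hr] at h1
    linarith
  have habs : ∀ r : ℝ, 0 < r → ∀ x, p x ≤ r → |f x| ≤ m * r := fun r hr x hx => by
    rw [abs_le]
    have := hle r hr (-x) (by rwa [map_neg_eq_map])
    rw [map_neg] at this
    exact ⟨by linarith, hle r hr x hx⟩
  have hm0 : 0 < m := by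
    by_contra! hm0
    refine hf (LinearMap.ext fun x => ?_)
    have hpos : 0 < p x + 1 := by have := apply_nonneg p x; linarith
    have h1 := habs (p x + 1) hpos x (by linarith)
    rw [LinearMap.zero_apply, ← abs_nonpos_iff]
    nlinarith
  set P : Set (En n) := {x | ∃ y z, p y ≤ s₁ / 3 ∧ |z| ≤ J * s₁ ∧ x = y + z • v} with hP
  have hPsymm : ∀ x ∈ P, -x ∈ P := by
    rintro x ⟨y, z, hy, hz, rfl⟩
    exact ⟨-y, -z, by rwa [map_neg_eq_map], by rwa [abs_neg], by module⟩
  have hPconv : Convex ℝ P := by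
    rintro x ⟨y, z, hy, hz, rfl⟩ x' ⟨y', z', hy', hz', rfl⟩ a b ha hb hab
    refine ⟨a • y + b • y', a * z + b * z', ?_, ?_, by module⟩
    · refine (map_add_le_add p _ _).trans ?_
      rw [map_smul_eq_mul, map_smul_eq_mul, Real.norm_of_nonneg ha, Real.norm_of_nonneg hb]
      calc a * p y + b * p y' ≤ a * (s₁ / 3) + b * (s₁ / 3) := by gcongr
        _ = s₁ / 3 := by rw [← add_mul, hab, one_mul]
    · refine (abs_add_le _ _).trans ?_
      rw [abs_mul, abs_mul, abs_of_nonneg ha, abs_of_nonneg hb]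
      calc a * |z| + b * |z'| ≤ a * (J * s₁) + b * (J * s₁) := by gcongr
        _ = J * s₁ := by rw [← add_mul, hab, one_mul]
  have hs3 : 0 < s₁ / 3 := by positivity
  have hKm : MeasurableSet {x | p x ≤ s₁ / 3} := by
    rw [seminorm_le_eq_smul p hs3]
    exact (hcpt.smul (s₁ / 3)).measurableSet
  have hvolP := mul_volume_le_of_disjoint_translates (W := P) hKm
    (fun j => ((j:ℝ) * s₁) • v) J
    (fun i _ j _ hij y hy z hz heq => by
      have h1 : f (z - y) = ((i:ℝ) - j) * s₁ * m := by
        have := congrArg f heq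
        simp only [map_add, map_smul, smul_eq_mul] at this
        rw [map_sub]; linarith
      have h2 : p (z - y) ≤ s₁ / 3 + s₁ / 3 := (map_sub_le_add p z y).trans (add_le_add hz hy)
      have h3 := habs _ (by positivity) _ h2
      rw [h1, abs_mul, abs_mul, abs_of_pos hs₁, abs_of_pos hm0] at h3
      have h4 : (1:ℝ) ≤ |(i:ℝ) - j| := by
        have : (i:ℤ) - j ≠ 0 := sub_ne_zero.2 (by exact_mod_cast hij)
        exact_mod_cast Int.one_le_abs this
      have h5 : 1 * (s₁ * m) ≤ |(i:ℝ) - j| * (s₁ * m) :=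
        mul_le_mul_of_nonneg_right h4 (by positivity)
      have h6 : 0 < s₁ * m := by positivity
      nlinarith)
    (fun i hi y hy => ⟨y, i * s₁, hy, by
      rw [abs_of_nonneg (by positivity)]
      have : (i:ℝ) ≤ J := by exact_mod_cast hi.le
      gcongr, add_comm _ _⟩)
  obtain ⟨g, hg, hg0, y, z, hy, hz, hgy⟩ := exists_isLattice_mem hPsymm hPconv (by
    refine lt_of_lt_of_le ?_ hvolP
    rw [volume_seminorm_le p hs3]
    calc (2:ENNReal) ^ n = ENNReal.ofReal (2 ^ n) := by
          rw [ENNReal.ofReal_pow (by norm_num)]; norm_num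
      _ < ENNReal.ofReal (J * ((s₁ / 3) ^ n * c)) :=
          (ENNReal.ofReal_lt_ofReal_iff (by positivity)).2 hJ2
      _ = J * (ENNReal.ofReal ((s₁ / 3) ^ n) * ENNReal.ofReal c) := by
          rw [ENNReal.ofReal_mul (by positivity), ENNReal.ofReal_natCast,
            ENNReal.ofReal_mul (by positivity)]
      _ ≤ _ := by gcongr)
  have hpv : p v ≤ 1 := hv
  have hpg : ∀ r : ℝ, |z| ≤ r → p g ≤ s₁ / 3 + r := fun r hr => by
    rw [hgy]
    refine (map_add_le_add p _ _).trans (add_le_add hy ?_)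
    rw [map_smul_eq_mul, Real.norm_eq_abs]
    nlinarith [abs_nonneg z, apply_nonneg p v]
  have hfg := hker g hg (hpg _ hz)
  have hzle : |z| ≤ s₁ / 3 := by
    have h1 : f y = -(z * m) := by
      rw [hgy, map_add, map_smul, smul_eq_mul] at hfg
      linarith
    have h2 := habs _ hs3 y hy
    rw [h1, abs_neg, abs_mul, abs_of_pos hm0, mul_comm] at h2
    exact le_of_mul_le_mul_left h2 hm0
  have h1 := hpg _ hzle
  have h2 := hmin g hg hg0
  linarith

/-- Seminorms bounded on a spanning subset of a finite set are uniformly bounded. -/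
lemma exists_seminorm_le {F : Set (En n)} (hF : F.Finite) (s : ℝ) : ∃ T : ℝ, 0 < T ∧
    ∀ G ⊆ F, Submodule.span ℝ G = ⊤ → ∀ p : Seminorm ℝ (En n), (∀ g ∈ G, p g ≤ s) →
      ∀ x, p x ≤ T * ‖x‖ := by
  have hpt : ∀ G : Set (En n), ∀ x ∈ Submodule.span ℝ G, ∃ R : ℝ, ∀ p : Seminorm ℝ (En n),
      (∀ g ∈ G, p g ≤ s) → p x ≤ R := by
    intro G x hx
    induction hx using Submodule.span_induction with
    | mem x hx => exact ⟨s, fun p hp => hp x hx⟩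
    | zero => exact ⟨0, fun p _ => by simp⟩
    | add x y _ _ hx hy =>
      obtain ⟨R, hR⟩ := hx
      obtain ⟨R', hR'⟩ := hy
      exact ⟨R + R', fun p hp => (map_add_le_add p x y).trans (add_le_add (hR p hp) (hR' p hp))⟩
    | smul a x _ hx =>
      obtain ⟨R, hR⟩ := hx
      exact ⟨‖a‖ * R, fun p hp => by
        rw [map_smul_eq_mul]; exact mul_le_mul_of_nonneg_left (hR p hp) (norm_nonneg a)⟩
  have hset : ∀ G : Set (En n), ∃ T : ℝ, Submodule.span ℝ G = ⊤ → ∀ p : Seminorm ℝ (En n),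
      (∀ g ∈ G, p g ≤ s) → ∀ x, p x ≤ T * ‖x‖ := by
    intro G
    by_cases hG : Submodule.span ℝ G = ⊤
    · choose R hR using fun i : Fin n => hpt G (EuclideanSpace.single i 1) (hG ▸ Submodule.mem_top)
      refine ⟨∑ i, R i, fun _ p hp x => ?_⟩
      have hx : x = ∑ i, x i • (EuclideanSpace.single i 1 : En n) := by
        have := (EuclideanSpace.basisFun (Fin n) ℝ).sum_repr x
        simpa using this.symm
      calc p x = p (∑ i, x i • (EuclideanSpace.single i 1 : En n)) := by rw [← hx]
        _ ≤ ∑ i, p (x i • (EuclideanSpace.single i 1 : En n)) :=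
          Finset.le_sum_of_subadditive p (map_zero p).le (map_add_le_add p) _ _
        _ ≤ ∑ i, R i * ‖x‖ := Finset.sum_le_sum fun i _ => by
          rw [map_smul_eq_mul, mul_comm]
          exact mul_le_mul (hR i p hp) (PiLp.norm_apply_le x i) (norm_nonneg _)
            ((apply_nonneg p _).trans (hR i p hp))
        _ = _ := by rw [Finset.sum_mul]
    · exact ⟨0, fun h => absurd h hG⟩
  choose T hT using hset
  obtain ⟨B, hB⟩ := (hF.finite_subsets.image T).bddAbove
  refine ⟨max B 1, by positivity, fun G hG hspan p hp x => (hT G hspan p hp x).trans ?_⟩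
  exact mul_le_mul_of_nonneg_right ((hB ⟨G, hG, rfl⟩).trans (le_max_left _ _)) (norm_nonneg x)

lemma finite_isLattice_of_isCompact {S : Set (En n)} (hS : IsCompact S) :
    {g | IsLattice g ∧ g ∈ S}.Finite := by
  set b := (EuclideanSpace.basisFun (Fin n) ℝ).toBasis with hb
  refine (ZSpan.setFinite_inter b hS.isBounded).subset fun g hg => ⟨hg.2, ?_⟩
  refine (b.mem_span_iff_repr_mem ℤ g).2 fun i => ?_
  obtain ⟨k, hk⟩ := hg.1 i
  refine ⟨k, ?_⟩
  rw [hb, OrthonormalBasis.coe_toBasis_repr_apply, EuclideanSpace.basisFun_repr, hk]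
  simp

end Lattices

section Bound

open Filter Topology
open scoped Pointwise
variable {n : ℕ} {l L m₁ m₂ : ℝ} {u : En n → ℝ → ℝ}

lemma NormalizedSol.exists_le_volume_sublevel (hu : NormalizedSol l L m₁ m₂ u) :
    ∃ c : ℝ, 0 < c ∧ ∀ h : ℝ, 0 < h → ENNReal.ofReal (c * √h ^ n) ≤ volume {x | u x 0 ≤ h} := by
  have hl := hu.l_pos
  have hv := hu.pinched 0 le_rfl
  have hL : 0 < L := hl.trans_le ((hv.le_det 0).trans (hv.det_le 0))
  set p : ℝ := 32 * (n + 1) ^ 2 with hp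
  have hp0 : 0 < p := by positivity
  refine ⟨L⁻¹ * ((1 / (8 * (n + 1))) ^ n * (√l / √p ^ n)), by positivity, fun h hh => ?_⟩
  obtain ⟨q₀, A, hA, hAdet, hbox⟩ := exists_section_box hl hv hu.initial_nonneg hh
    (hu.isCompact_sublevel h) (y := 0) (by rw [hu.zero]; exact hh)
  have h2 : 2 * (h / 2) = h := by ring
  have hvol := le_volume_sublevel hl hv hu.initial_nonneg (h := h / 2) (by positivity)
    (by rw [h2]; exact hu.isCompact_sublevel h) (y := 0) (by rw [hu.zero]; positivity) hA
    (by rw [h2]; exact hbox)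
  rw [h2] at hvol
  have hA0 : 0 < |A.det| := abs_pos.2 hA
  have hdet : √l * |A.det| ≤ √p ^ n * √h ^ n := by
    refine abs_le_of_sq_le_sq' ?_ (by positivity) |>.2
    rw [mul_pow, sq_abs, Real.sq_sqrt hl.le, ← mul_pow, ← Real.sqrt_mul hp0.le, ← pow_mul,
      mul_comm n 2, pow_mul, Real.sq_sqrt (by positivity)]
    exact hAdet
  have hreal : L⁻¹ * ((1 / (8 * (n + 1))) ^ n * (√l / √p ^ n)) * √h ^ n
      ≤ L⁻¹ * ((h / 2 / (4 * (n + 1))) ^ n / |A.det|) := by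
    have e1 : (h / 2 / (4 * (n + 1))) ^ n = (1 / (8 * (n + 1))) ^ n * (√h ^ n * √h ^ n) := by
      rw [← mul_pow, Real.mul_self_sqrt hh.le, ← mul_pow]
      congr 1
      field_simp
      ring
    rw [mul_assoc, e1]
    refine mul_le_mul_of_nonneg_left ?_ (by positivity)
    rw [mul_assoc, mul_div_assoc]
    refine mul_le_mul_of_nonneg_left ?_ (by positivity)
    rw [le_div_iff₀ hA0, div_mul_eq_mul_div, div_mul_eq_mul_div, div_le_iff₀ (by positivity)]
    have := mul_le_mul_of_nonneg_left hdet (by positivity : 0 ≤ √h ^ n)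
    linarith
  calc _ ≤ ENNReal.ofReal (L⁻¹ * ((h / 2 / (4 * (n + 1))) ^ n / |A.det|)) :=
        ENNReal.ofReal_le_ofReal hreal
    _ ≤ ENNReal.ofReal L⁻¹ * (ENNReal.ofReal L * volume {x | u x 0 ≤ h}) := by
        rw [ENNReal.ofReal_mul (by positivity)]
        gcongr
    _ = _ := by
        rw [← mul_assoc, ← ENNReal.ofReal_mul (by positivity), inv_mul_cancel₀ hL.ne',
          ENNReal.ofReal_one, one_mul]

lemma NormalizedSol.exists_le_volume_symmetrized (hu : NormalizedSol l L m₁ m₂ u) :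
    ∃ c : ℝ, 0 < c ∧ ∀ h : ℝ, 0 < h →
      ENNReal.ofReal (c * √h ^ n) ≤ volume {x | u x 0 ≤ h ∧ u (-x) 0 ≤ h} := by
  obtain ⟨c, hc, hvol⟩ := hu.exists_le_volume_sublevel
  obtain ⟨C, hC, hbal⟩ := exists_balance n L hu.l_pos
  refine ⟨c / √C ^ n, by positivity, fun h hh => ?_⟩
  refine le_trans (le_of_eq ?_) ((hvol (h / C) (by positivity)).trans (measure_mono ?_))
  · rw [Real.sqrt_div hh.le, div_pow]; congr 1; ring
  · intro x hx
    have hx' : u x 0 ≤ h / C := hx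
    have h1 := hbal _ (hu.pinched 0 le_rfl) 0 x
    rw [zero_add, zero_sub, hu.tang_zero, hu.tang_zero] at h1
    have h2 : C * u x 0 ≤ h := by rwa [le_div_iff₀' (by positivity)] at hx'
    have h3 := hu.initial_nonneg x
    exact ⟨by nlinarith, h1.trans h2⟩

/-- The rescaled gauge of a symmetrized section. -/
lemma NormalizedSol.exists_seminorm (hu : NormalizedSol l L m₁ m₂ u) {h : ℝ} (hh : 0 < h) :
    ∃ p : Seminorm ℝ (En n), ∀ x, p x ≤ √h ↔ u x 0 ≤ h ∧ u (-x) 0 ≤ h := by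
  have hv := hu.pinched 0 le_rfl
  set B : Set (En n) := {x | u x 0 ≤ h ∧ u (-x) 0 ≤ h} with hB
  have hconv : Convex ℝ B := by
    have h2 : Convex ℝ {x : En n | u (-x) 0 ≤ h} := (convex_sublevel hv h).neg
    exact (convex_sublevel hv h).inter h2
  have hneg : Continuous fun x : En n => u (-x) 0 := hv.continuous.comp continuous_neg
  have hclosed : IsClosed B := (isClosed_sublevel hv h).inter (isClosed_le hneg continuous_const)
  have hnhds : B ∈ 𝓝 0 := by
    refine Filter.inter_mem (hv.continuous.continuousAt.eventually_le_const ?_)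
      (hneg.continuousAt.eventually_le_const ?_)
    · show u 0 0 < h
      rw [hu.zero]; exact hh
    · show u (-0) 0 < h
      rw [neg_zero, hu.zero]; exact hh
  have hsymm : ∀ x ∈ B, -x ∈ B := fun x hx => ⟨hx.2, by rw [neg_neg]; exact hx.1⟩
  have hbal : Balanced ℝ B := by
    intro a ha
    rintro _ ⟨x, hx, rfl⟩
    rw [Real.norm_eq_abs, abs_le] at ha
    have h0 := hconv hx (hsymm x hx) (by linarith : (0:ℝ) ≤ (1 + a) / 2)
      (by linarith : (0:ℝ) ≤ (1 - a) / 2) (by ring)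
    have e1 : ((1 + a) / 2) • x + ((1 - a) / 2) • -x = a • x := by module
    rwa [e1] at h0
  have hρ : 0 < √h := Real.sqrt_pos.2 hh
  refine ⟨Real.toNNReal √h • gaugeSeminorm hbal hconv (absorbent_nhds_zero hnhds), fun x => ?_⟩
  have h1 := gauge_le_one_iff_mem_closure hconv hnhds (x := x)
  rw [hclosed.closure_eq] at h1
  refine Iff.trans ?_ h1
  rw [smul_apply, NNReal.smul_def, Real.coe_toNNReal _ hρ.le, smul_eq_mul]
  exact mul_le_iff_le_one_right hρ

/-- At a height where scaled second differences are bounded linearly, the second difference in a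
lattice direction is bounded by the square of its gauge. -/
lemma NormalizedSol.sd_le_of_seminorm_le (hu : NormalizedSol l L m₁ m₂ u) {h C : ℝ} (hh : 0 < h)
    (hC : ∀ q ∈ scaledDiffs u h, q ≤ C * h) {p : Seminorm ℝ (En n)}
    (hp : ∀ x, p x ≤ √h ↔ u x 0 ≤ h ∧ u (-x) 0 ≤ h) {g : En n} (hg : IsLattice g) (hg0 : g ≠ 0)
    {s : ℝ} (hs : 0 < s) (hsh : s ≤ √h) (hpg : p g ≤ s) {x : En n} {t : ℝ} (ht : t ≤ 0)
    (hx : u x t ≤ h) : sd u g x t ≤ 4 * C * s ^ 2 := by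
  set K : ℕ := ⌊√h / s⌋₊ with hKdef
  have hK : 1 ≤ K := Nat.le_floor (by rw [Nat.cast_one, le_div_iff₀ hs, one_mul]; exact hsh)
  have hK' : (1:ℝ) ≤ K := by exact_mod_cast hK
  have hKs : (K:ℝ) * s ≤ √h := by
    rw [← le_div_iff₀ hs]; exact Nat.floor_le (by positivity)
  have hKs' : √h ≤ 2 * K * s := by
    rw [← div_le_iff₀ hs]
    have := (Nat.lt_floor_add_one (√h / s)).le
    rw [← hKdef] at this
    linarith
  obtain ⟨h1, h2⟩ := (hp ((K:ℝ) • g)).1 (by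
    rw [map_smul_eq_mul, Real.norm_natCast]
    exact (mul_le_mul_of_nonneg_left hpg (by positivity)).trans hKs)
  have h3 := hC _ ⟨g, hg, hg0, K, hK, h1, h2, x, t, ht, hx, rfl⟩
  have h4 : h ≤ (2 * K * s) ^ 2 := by
    rw [← Real.sq_sqrt hh.le]; exact pow_le_pow_left₀ (Real.sqrt_nonneg h) hKs' 2
  have h5 := mul_le_mul_of_nonneg_right h4 (hu.sd_nonneg g x ht)
  have h6 := mul_le_mul_of_nonneg_left h3 (by positivity : 0 ≤ 4 * s ^ 2)
  refine le_of_mul_le_mul_left ?_ hh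
  linarith

/-- Uniform quadratic bound for second differences in lattice directions. -/
lemma NormalizedSol.exists_sd_le (hu : NormalizedSol l L m₁ m₂ u) : ∃ M : ℝ, ∀ e : En n,
    IsLattice e → e ≠ 0 → ∀ x, ∀ t ≤ 0, sd u e x t ≤ M * ‖e‖ ^ 2 := by
  obtain ⟨C, hC, hheight⟩ := hu.exists_height
  obtain ⟨c, hc, hvol⟩ := hu.exists_le_volume_symmetrized
  obtain ⟨γ, hγ, hgrow⟩ := exists_linear_growth hu.l_pos (hu.pinched 0 le_rfl) 0
  set s₁ : ℝ := √(γ / (8 * C)) with hs₁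
  have hs₁0 : 0 < s₁ := by positivity
  have hs₁sq : 4 * C * s₁ ^ 2 < γ := by
    rw [hs₁, Real.sq_sqrt (by positivity)]
    have : 4 * C * (γ / (8 * C)) = γ / 2 := by field_simp; ring
    linarith
  obtain ⟨s₂, hs₂, hlat⟩ := exists_lattice_apply_ne_zero n hc hs₁0
  obtain ⟨T, hT, hsemi⟩ := exists_seminorm_le
    (finite_isLattice_of_isCompact (hu.isCompact_sublevel (4 * C * s₂ ^ 2))) s₂
  refine ⟨4 * C * T ^ 2, fun e he he0 x t ht => ?_⟩
  have hen : 0 < ‖e‖ := norm_pos_iff.2 he0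
  obtain ⟨h, hH, h1, hgood⟩ := hheight (max (u x t) (max (s₁ ^ 2) (max (s₂ ^ 2) ((T * ‖e‖) ^ 2))))
  simp only [max_le_iff] at hH
  obtain ⟨hxh, hs₁h, hs₂h, hTh⟩ := hH
  have hh : 0 < h := by linarith
  have hρ : 0 < √h := Real.sqrt_pos.2 hh
  obtain ⟨p, hp⟩ := hu.exists_seminorm hh
  have hzero : u 0 0 ≤ h := by rw [hu.zero]; exact hh.le
  have hball : {x | p x ≤ √h} = {x | u x 0 ≤ h ∧ u (-x) 0 ≤ h} := by
    ext x; exact hp x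
  have hstart : ∀ g s, IsLattice g → 0 < s → s ≤ √h → p g ≤ s → u g 0 ≤ 4 * C * s ^ 2 := by
    intro g s hg hs hsh hpg
    rcases eq_or_ne g 0 with rfl | hg0
    · rw [hu.zero]; positivity
    have := hu.sd_le_of_seminorm_le hh hgood hp hg hg0 hs hsh hpg le_rfl hzero
    rw [sd, zero_add, zero_sub, hu.zero] at this
    have := hu.initial_nonneg (-g)
    linarith
  have hbig : ∀ g, IsLattice g → g ≠ 0 → s₁ < p g := by
    intro g hg hg0
    by_contra! hle
    have h2 := hstart g s₁ hg hs₁0 (Real.le_sqrt_of_sq_le hs₁h) hle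
    have h3 := hg.one_le_norm hg0
    have h4 := hgrow g (by rwa [sub_zero])
    rw [sub_zero, hu.tang_zero] at h4
    nlinarith
  have hcpt : IsCompact {x | p x ≤ 1} := by
    have h2 : {x | p x ≤ 1} = (√h)⁻¹ • {x | p x ≤ √h} := by
      rw [seminorm_le_eq_smul p hρ, smul_smul, inv_mul_cancel₀ hρ.ne', one_smul]
    rw [h2, hball]
    refine IsCompact.smul _ ((hu.isCompact_sublevel h).inter_right ?_)
    exact isClosed_le ((hu.pinched 0 le_rfl).continuous.comp continuous_neg) continuous_const
  have hpvol : ENNReal.ofReal c ≤ volume {x | p x ≤ 1} := by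
    have h2 := hvol h hh
    rw [← hball, volume_seminorm_le p hρ, mul_comm c, ENNReal.ofReal_mul (by positivity)] at h2
    exact (ENNReal.mul_le_mul_iff_right (ENNReal.ofReal_pos.2 (by positivity)).ne' ENNReal.ofReal_ne_top).1 h2
  have hspan : Submodule.span ℝ {g | IsLattice g ∧ p g ≤ s₂} = ⊤ := by
    by_contra hne
    obtain ⟨f, hf0, hf⟩ := Submodule.exists_le_ker_of_lt_top _ (lt_top_iff_ne_top.2 hne)
    obtain ⟨g, hg, hpg, hfg⟩ := hlat p hcpt hpvol hbig f hf0
    exact hfg (hf (Submodule.subset_span ⟨hg, hpg⟩))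
  have hpe := hsemi {g | IsLattice g ∧ p g ≤ s₂}
    (fun g hg => ⟨hg.1, hstart g s₂ hg.1 hs₂ (Real.le_sqrt_of_sq_le hs₂h) hg.2⟩) hspan p
    (fun g hg => hg.2) e
  have := hu.sd_le_of_seminorm_le hh hgood hp he he0 (by positivity)
    (Real.le_sqrt_of_sq_le hTh) hpe ht hxh
  exact this.trans (le_of_eq (by ring))

end Bound

section Setup

variable {n : ℕ}

lemma apply_add_lattice_eq {f : En n → ℝ}
    (hf : ∀ (x : En n) (i : Fin n), f (x + EuclideanSpace.single i 1) = f x)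
    {e : En n} (he : IsLattice e) (x : En n) : f (x + e) = f x := by
  let P : AddSubgroup (En n) :=
    { carrier := {a | ∀ x, f (x + a) = f x}
      zero_mem' := fun x => by rw [add_zero]
      add_mem' := fun {a b} ha hb x => by rw [← add_assoc, hb, ha]
      neg_mem' := fun {a} ha x => by rw [← ha (x + -a), neg_add_cancel_right] }
  choose k hk using he
  have he : e = ∑ i, k i • (EuclideanSpace.single i 1 : En n) := by
    ext j
    simp [hk, Finset.sum_apply, Pi.single_apply]
  have hmem : e ∈ P := by
    rw [he]
    exact P.sum_mem fun i _ => P.zsmul_mem (fun x => hf x i) (k i)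
  exact hmem x

lemma IsC2kOn.contDiff {u : En n → ℝ → ℝ} (hu : IsC2kOn 1 u (halfSpace n)) {t : ℝ} (ht : t ≤ 0) :
    ContDiff ℝ 2 fun x => u x t := by
  refine contDiff_iff_contDiffAt.2 fun x => ?_
  simpa using ((hu 2 0 (by norm_num)).1 (x, t) ⟨mem_univ x, ht⟩).1

lemma IsC2kOn.hasDerivAt {u : En n → ℝ → ℝ} (hu : IsC2kOn 1 u (halfSpace n)) (x : En n) {t : ℝ}
    (ht : t ≤ 0) : HasDerivAt (u x) (timeDeriv u x t) t := by
  have h := ((hu 0 1 (by norm_num)).1 (x, t) ⟨mem_univ x, ht⟩).2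
  exact (h.differentiableAt (by norm_num)).hasDerivAt

lemma ParabolicallyConvexOn.convexOn {u : En n → ℝ → ℝ}
    (hu : ParabolicallyConvexOn (halfSpace n) u) {t : ℝ} (ht : t ≤ 0) :
    ConvexOn ℝ univ fun x => u x t := by
  have h := hu.1 t
  rwa [show {x : En n | (x, t) ∈ halfSpace n} = univ from
    eq_univ_of_forall fun x => ⟨mem_univ x, ht⟩] at h

end Setup

end PMA

/-- uniform boundedness of all second-order difference quotients. -/
theorem stmt13
    (n : ℕ) (hn : 1 ≤ n) (α : ℝ) (hα : α ∈ Set.Ioo (0:ℝ) 1)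
    (f₁ : En n → ℝ) (f₂ : ℝ → ℝ)
    (hf₁pos : ∀ x, 0 < f₁ x) (hf₂pos : ∀ t : ℝ, t ≤ 0 → 0 < f₂ t)
    (hf₁hold : ∃ K : NNReal, HolderWith K α.toNNReal f₁)
    (hf₂hold : ∃ K : NNReal, HolderOnWith K (α/2).toNNReal f₂ (Set.Iic 0))
    (hf₁per : ∀ (x : En n) (i : Fin n), f₁ (x + EuclideanSpace.single i 1) = f₁ x)
    (hf₂per : ∀ t : ℝ, t ≤ 0 → f₂ (t - 1) = f₂ t)
    (hf₁avg : ∫ x in {x : En n | ∀ i, x i ∈ Set.Icc (0:ℝ) 1}, f₁ x = 1)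
    (hf₂avg : ∫ t in Set.Icc (-1:ℝ) 0, f₂ t = 1)
    (lam Λ : ℝ) (hlam : 0 < lam)
    (hfbdd : ∀ (x : En n) (t : ℝ), t ≤ 0 → lam ≤ f₁ x * f₂ t ∧ f₁ x * f₂ t ≤ Λ)
    (u : En n → ℝ → ℝ)
    (hureg : PMA.IsC2kOn 1 u (PMA.halfSpace n))
    (huconv : PMA.ParabolicallyConvexOn (PMA.halfSpace n) u)
    (m₁ m₂ : ℝ) (hm₁ : 0 < m₁) (hm₂ : 0 < m₂)
    (hut : ∀ (x : En n) (t : ℝ), t ≤ 0 →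
      m₁ ≤ -PMA.timeDeriv u x t ∧ -PMA.timeDeriv u x t ≤ m₂)
    (heq : ∀ (x : En n) (t : ℝ), t ≤ 0 →
      -PMA.timeDeriv u x t * (PMA.spaceHess u x t).det = f₁ x * f₂ t)
    (hu0 : u 0 0 = 0) (hDu0 : PMA.spaceGrad u 0 0 = 0)
    :
    ∃ M : ℝ, ∀ e : En n, (∀ i, ∃ k : ℤ, e i = (k : ℝ)) → e ≠ 0 →
      ∀ (x : En n) (t : ℝ), t ≤ 0 → PMA.sdq u e x t ≤ M := by
  have hdet : ∀ x t, t ≤ 0 → 0 < (PMA.spaceHess u x t).det := fun x t ht =>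
    pos_of_mul_pos_right (by rw [heq x t ht]; exact hlam.trans_le (hfbdd x t ht).1)
      (hm₁.le.trans (hut x t ht).1)
  have hsol : PMA.NormalizedSol (lam / m₂) (Λ / m₁) m₁ m₂ u :=
    { pinched := fun t ht =>
        { contDiff := hureg.contDiff ht
          convexOn := huconv.convexOn ht
          le_det := fun x => by
            rw [div_le_iff₀ hm₂, mul_comm]
            exact ((hfbdd x t ht).1.trans_eq (heq x t ht).symm).trans
              (mul_le_mul_of_nonneg_right (hut x t ht).2 (hdet x t ht).le)
          det_le := fun x => by
            rw [le_div_iff₀ hm₁, mul_comm]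
            exact (mul_le_mul_of_nonneg_right (hut x t ht).1 (hdet x t ht).le).trans
              ((heq x t ht).trans_le (hfbdd x t ht).2) }
      hasDerivAt := fun x t ht => hureg.hasDerivAt x ht
      le_neg_timeDeriv := fun x t ht => (hut x t ht).1
      neg_timeDeriv_le := fun x t ht => (hut x t ht).2
      periodic := fun e he x t ht => by
        refine (heq (x + e) t ht).trans (Eq.trans ?_ (heq x t ht).symm)
        rw [PMA.apply_add_lattice_eq hf₁per he]
      l_pos := div_pos hlam hm₂
      m₁_pos := hm₁
      m₂_pos := hm₂
      zero := hu0
      gradient_zero := hDu0 }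
  obtain ⟨M, hM⟩ := hsol.exists_sd_le
  refine ⟨M, fun e he he0 x t ht => ?_⟩
  exact (div_le_iff₀ (pow_pos (norm_pos_iff.2 he0) 2)).2 (hM e he he0 x t ht)
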